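/- Let K ∈ ℝ, N ∈ [1,∞), let (X,d,m) be a CD*(K,N) metric measure space having the good transport property (GT), let mu, nu ∈ P2(X), assume mu <= C*m for some constant C > 0, and let pi ∈ OptGeo(mu,nu) be the unique optimal geodesic plan from mu to nu. Then pi can be written as pi = Σ_{n∈ℕ} pi_n, where each pi_n is a nonnegative Borel measure on Geo(X) and for every n ∈ ℕ and every t ∈ [0,1) there is a finite constant C_n(t) such that (e_t)#pi_n <= C_n(t)*m. -/

import Mathlib

open MeasureTheory Metric Set unitInterval ENNReal NNReal

noncomputable section

variable {X : Type*} [MetricSpace X]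

/-- A constant speed minimizing geodesic parametrized on `[0,1]`. -/
def IsUnitGeodesic (γ : C(unitInterval, X)) : Prop :=
  ∀ s t : unitInterval, dist (γ s) (γ t) = |(s : ℝ) - (t : ℝ)| * dist (γ 0) (γ 1)

/-- The space of constant speed minimizing geodesics, with the sup distance. -/
def Geo (X : Type*) [MetricSpace X] : Type _ :=
  { γ : C(unitInterval, X) // IsUnitGeodesic γ }

instance : MetricSpace (Geo X) := Subtype.metricSpace
instance : MeasurableSpace (Geo X) := borel _
instance : BorelSpace (Geo X) := ⟨rfl⟩

/-- Evaluation map `e_t`. -/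
def eval (t : unitInterval) (γ : Geo X) : X := γ.1 t

/-- `(X,d)` is a geodesic space: any two points are joined by a geodesic. -/
def IsGeodesicSpace (X : Type*) [MetricSpace X] : Prop :=
  ∀ x y : X, ∃ γ : Geo X, eval 0 γ = x ∧ eval 1 γ = y

/-- The (topological) support of a measure. -/
def measSupport {Y : Type*} [TopologicalSpace Y] [MeasurableSpace Y] (μ : Measure Y) : Set Y :=
  {y | ∀ U ∈ nhds y, 0 < μ U}

variable [MeasurableSpace X]

/-- Finite second moment. -/
def HasFiniteSecondMoment (μ : Measure X) : Prop :=
  ∃ x₀ : X, ∫⁻ x, ENNReal.ofReal (dist x x₀ ^ 2) ∂μ ≠ ⊤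

/-- The transport cost of a plan on the space of geodesics. -/
def transportCost (π : Measure (Geo X)) : ℝ≥0∞ :=
  ∫⁻ γ, ENNReal.ofReal (dist (eval 0 γ) (eval 1 γ) ^ 2) ∂π

/-- `π ∈ OptGeo(μ,ν)`: an optimal geodesic plan from `μ` to `ν`. -/
def IsOptGeo (μ ν : Measure X) (π : Measure (Geo X)) : Prop :=
  IsProbabilityMeasure π ∧ π.map (eval 0) = μ ∧ π.map (eval 1) = ν ∧
    ∀ π' : Measure (Geo X), IsProbabilityMeasure π' →
      π'.map (eval 0) = μ → π'.map (eval 1) = ν →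
      transportCost π ≤ transportCost π'

/-- The distortion coefficients `σ_{K,N}^{(t)}(θ)`. -/
def sigmaCoeff (K N t θ : ℝ) : ℝ≥0∞ :=
  if N * Real.pi ^ 2 ≤ K * θ ^ 2 then ⊤
  else if 0 < K * θ ^ 2 then
    ENNReal.ofReal (Real.sin (t * θ * Real.sqrt (K / N)) / Real.sin (θ * Real.sqrt (K / N)))
  else if K * θ ^ 2 = 0 then ENNReal.ofReal t
  else ENNReal.ofReal (Real.sinh (t * θ * Real.sqrt (-K / N)) / Real.sinh (θ * Real.sqrt (-K / N)))

/-- The distortion coefficients `τ_{K,N}^{(t)}(θ)`. -/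
def tauCoeff (K N t θ : ℝ) : ℝ≥0∞ :=
  if N = 1 then
    (if K ≤ 0 then ENNReal.ofReal t else if θ = 0 then ENNReal.ofReal t else ⊤)
  else ENNReal.ofReal t ^ (1 / N) * sigmaCoeff K (N - 1) t θ ^ ((N - 1) / N)

/-- The (reduced) curvature dimension condition `CD*(K,N)`. -/
def IsCDStar (K N : ℝ) (m : Measure X) : Prop :=
  ∀ μ₀ μ₁ : Measure X, IsProbabilityMeasure μ₀ → IsProbabilityMeasure μ₁ →
    (∃ s : Set X, Bornology.IsBounded s ∧ μ₀ sᶜ = 0 ∧ μ₁ sᶜ = 0) →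
    ∃ π : Measure (Geo X), IsOptGeo μ₀ μ₁ π ∧
      ∀ t : unitInterval, ∀ N' : ℝ, N ≤ N' →
        ∫⁻ γ, (sigmaCoeff K N' (1 - (t : ℝ)) (dist (eval 0 γ) (eval 1 γ)) *
                 ((π.map (eval 0)).rnDeriv m (eval 0 γ)) ^ (-(1 / N')) +
               sigmaCoeff K N' (t : ℝ) (dist (eval 0 γ) (eval 1 γ)) *
                 ((π.map (eval 1)).rnDeriv m (eval 1 γ)) ^ (-(1 / N'))) ∂π
          ≤ ∫⁻ x, ((π.map (eval t)).rnDeriv m x) ^ (1 - 1 / N') ∂m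

/-- The good transport property (GT): between absolutely continuous measures in `P₂(X)` there is
a unique optimal geodesic plan, and it is induced by a map from every intermediate time. -/
def GoodTransport (m : Measure X) : Prop :=
  ∀ μ ν : Measure X, IsProbabilityMeasure μ → IsProbabilityMeasure ν →
    HasFiniteSecondMoment μ → HasFiniteSecondMoment ν → μ ≪ m → ν ≪ m →
    (∃! π : Measure (Geo X), IsOptGeo μ ν π) ∧
    ∀ π : Measure (Geo X), IsOptGeo μ ν π → ∀ t : unitInterval,
      ∃ T : X → Geo X, Measurable T ∧ π = (π.map (eval t)).map T

/-- `c`-concavity (with `c = d²/2`) for functions with values in `ℝ ∪ {-∞}`. -/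
def cConcave (φ : X → EReal) : Prop :=
  (∃ x, φ x ≠ ⊥) ∧ (∀ x, φ x ≠ ⊤) ∧
    ∃ ψ : X → EReal, (∀ y, ψ y ≠ ⊤) ∧
      ∀ x, φ x = ⨅ y, ((dist x y ^ 2 / 2 : ℝ) : EReal) - ψ y

/-- The `c`-transform `φᶜ`. -/
def cTransform (φ : X → EReal) : X → EReal :=
  fun y => ⨅ x, ((dist x y ^ 2 / 2 : ℝ) : EReal) - φ x

/-- The `c`-superdifferential `∂ᶜφ`. -/
def cSuperdiff (φ : X → EReal) : Set (X × X) :=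
  {p | φ p.1 + cTransform φ p.2 = ((dist p.1 p.2 ^ 2 / 2 : ℝ) : EReal)}

/-- Kantorovich potential from `μ` to `ν`. -/
def IsKantorovichPotential (μ ν : Measure X) (φ : X → EReal) : Prop :=
  cConcave φ ∧ ∀ π : Measure (Geo X), IsOptGeo μ ν π →
    measSupport (π.map (fun γ => (eval 0 γ, eval 1 γ))) ⊆ cSuperdiff φ

set_option linter.unusedSectionVars false
set_option linter.unusedVariables false

lemma eval_dist (γ : Geo X) (s t : unitInterval) :
    dist (eval s γ) (eval t γ) = |(s : ℝ) - (t : ℝ)| * dist (eval 0 γ) (eval 1 γ) := γ.2 s t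

lemma continuous_geval (t : unitInterval) : Continuous (eval t : Geo X → X) := by
  unfold eval
  exact (continuous_eval_const t).comp continuous_subtype_val

lemma measurable_geval [BorelSpace X] (t : unitInterval) : Measurable (eval t : Geo X → X) :=
  (continuous_geval t).measurable

/-- Affine interpolation in the unit interval. -/
def aff (a b l : unitInterval) : unitInterval :=
  ⟨(1 - (l : ℝ)) * a + l * b, by
    have h1 := a.2.1; have h2 := a.2.2; have h3 := b.2.1; have h4 := b.2.2
    have h5 := l.2.1; have h6 := l.2.2
    constructor <;> nlinarith⟩

lemma aff_zero (a b : unitInterval) : aff a b 0 = a := by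
  apply Subtype.ext; simp [aff]

lemma aff_one (a b : unitInterval) : aff a b 1 = b := by
  apply Subtype.ext; simp [aff]

lemma continuous_aff (a b : unitInterval) : Continuous (aff a b) := by
  unfold aff
  fun_prop

/-- Restriction of a geodesic. -/
def restr (a b : unitInterval) (γ : Geo X) : Geo X :=
  ⟨γ.1.comp ⟨aff a b, continuous_aff a b⟩, by
    intro s t
    have h1 := γ.2 (aff a b s) (aff a b t)
    have h2 := γ.2 (aff a b 0) (aff a b 1)
    simp only [ContinuousMap.comp_apply, ContinuousMap.coe_mk]
    rw [h1, h2, ← mul_assoc, ← abs_mul]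
    congr 1
    rw [aff_zero, aff_one, ← abs_neg]
    congr 1
    simp only [aff]
    ring⟩

lemma eval_restr (a b l : unitInterval) (γ : Geo X) :
    eval l (restr a b γ) = eval (aff a b l) γ := rfl

lemma continuous_restr (a b : unitInterval) : Continuous (restr a b : Geo X → Geo X) := by
  apply Continuous.subtype_mk
  exact (ContinuousMap.continuous_precomp _).comp continuous_subtype_val

instance instSCGeo [TopologicalSpace.SeparableSpace X] : SecondCountableTopology (Geo X) := by
  have : SecondCountableTopology X := UniformSpace.secondCountable_of_separable X
  exact TopologicalSpace.Subtype.secondCountableTopology _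

lemma exists_dist_bound {B Y : Set X} (hB : IsCompact B) (hY : IsCompact Y) :
    ∃ D : ℝ, 0 < D ∧ ∀ x ∈ B, ∀ y ∈ Y, dist x y ≤ D := by
  obtain ⟨D, hD⟩ := Metric.isBounded_iff.1 (hB.union hY).isBounded
  exact ⟨max D 1, by positivity,
    fun x hx y hy => (hD (Or.inl hx) (Or.inr hy)).trans (le_max_left _ _)⟩

lemma isCompact_geo [ProperSpace X] {B Y : Set X} (hB : IsCompact B) (hY : IsCompact Y) :
    IsCompact {γ : Geo X | eval 0 γ ∈ B ∧ eval 1 γ ∈ Y} := by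
  obtain ⟨D, hD0, hD⟩ := exists_dist_bound hB hY
  rcases B.eq_empty_or_nonempty with rfl | ⟨x0, hx0⟩
  · simp
  obtain ⟨D', hD'0, hD'⟩ := exists_dist_bound hB hB
  let S : Set C(unitInterval, X) := {γ | IsUnitGeodesic γ ∧ γ 0 ∈ B ∧ γ 1 ∈ Y}
  have key : IsCompact S := by
    apply ArzelaAscoli.isCompact_of_equicontinuous
    · have himg : ContinuousMap.toFun '' S = {f : unitInterval → X |
          (∀ s t : unitInterval, dist (f s) (f t) = |(s : ℝ) - (t : ℝ)| * dist (f 0) (f 1)) ∧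
            f 0 ∈ B ∧ f 1 ∈ Y} := by
        ext f
        constructor
        · rintro ⟨γ, hγ, rfl⟩
          exact hγ
        · rintro ⟨h1, h2, h3⟩
          have hc : Continuous f := by
            apply LipschitzWith.continuous (K := (dist (f 0) (f 1)).toNNReal)
            apply LipschitzWith.of_dist_le_mul
            intro s t
            rw [h1 s t, Real.coe_toNNReal _ dist_nonneg, mul_comm]
            rfl
          exact ⟨⟨f, hc⟩, ⟨h1, h2, h3⟩, rfl⟩
      rw [himg]
      apply IsCompact.of_isClosed_subset
        (isCompact_univ_pi (fun _ : unitInterval => isCompact_closedBall x0 (D + D')))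
      · have e1 : {f : unitInterval → X |
          (∀ s t : unitInterval, dist (f s) (f t) = |(s : ℝ) - (t : ℝ)| * dist (f 0) (f 1)) ∧
            f 0 ∈ B ∧ f 1 ∈ Y} = (⋂ s : unitInterval, ⋂ t : unitInterval,
            {f : unitInterval → X | dist (f s) (f t) = |(s : ℝ) - (t : ℝ)| * dist (f 0) (f 1)}) ∩
            ({f | f 0 ∈ B} ∩ {f | f 1 ∈ Y}) := by
          ext f
          constructor
          · rintro ⟨h1, h2, h3⟩
            exact ⟨Set.mem_iInter.2 fun s => Set.mem_iInter.2 fun t => h1 s t, h2, h3⟩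
          · rintro ⟨h1, h2, h3⟩
            exact ⟨fun s t => Set.mem_iInter.1 (Set.mem_iInter.1 h1 s) t, h2, h3⟩
        rw [e1]
        refine IsClosed.inter ?_ (IsClosed.inter ?_ ?_)
        · refine isClosed_iInter fun s => isClosed_iInter fun t => isClosed_eq ?_ ?_ <;> fun_prop
        · exact hB.isClosed.preimage (continuous_apply 0)
        · exact hY.isClosed.preimage (continuous_apply 1)
      · rintro f ⟨h1, h2, h3⟩ s -
        rw [mem_closedBall]
        have a1 := h1 s 0
        have a2 := hD _ h2 _ h3
        have a3 := hD' _ h2 _ hx0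
        have a4 : |(s : ℝ) - ((0 : unitInterval) : ℝ)| ≤ 1 := by
          simp [abs_of_nonneg s.2.1, s.2.2]
        have a5 := dist_triangle (f s) (f 0) x0
        have a6 := mul_le_mul a4 a2 dist_nonneg zero_le_one
        linarith
    · apply UniformEquicontinuous.equicontinuous
      apply LipschitzWith.uniformEquicontinuous _ D.toNNReal
      rintro ⟨γ, h1, h2, h3⟩
      apply LipschitzWith.of_dist_le_mul
      intro s t
      rw [Real.coe_toNNReal _ hD0.le]
      have := h1 s t
      simp only
      rw [this, mul_comm]
      exact mul_le_mul_of_nonneg_right (hD _ h2 _ h3) (abs_nonneg _)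
  refine (Subtype.isCompact_iff (p := fun γ : C(unitInterval, X) => IsUnitGeodesic γ)).2 ?_
  convert key using 1
  ext γ
  constructor
  · rintro ⟨g, hg, rfl⟩
    exact ⟨g.2, hg⟩
  · rintro ⟨h1, h2⟩
    exact ⟨⟨γ, h1⟩, h2, rfl⟩

/-- The set of geodesics from `B` to `Y` in the contact set of the potential `φ`. -/
def Contact (φ : X → ℝ) (B Y : Set X) : Set (Geo X) :=
  {γ | eval 0 γ ∈ B ∧ eval 1 γ ∈ Y ∧ ∀ x ∈ B,
    φ x + dist (eval 0 γ) (eval 1 γ) ^ 2 ≤ φ (eval 0 γ) + dist x (eval 1 γ) ^ 2}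

lemma isCompact_contact [ProperSpace X] {φ : X → ℝ} (hφ : Continuous φ) {B Y : Set X}
    (hB : IsCompact B) (hY : IsCompact Y) : IsCompact (Contact φ B Y) := by
  have h0 := continuous_geval (X := X) 0
  have h1 := continuous_geval (X := X) 1
  have : Contact φ B Y = {γ : Geo X | eval 0 γ ∈ B ∧ eval 1 γ ∈ Y} ∩ ⋂ x ∈ B, {γ : Geo X |
      φ x + dist (eval 0 γ) (eval 1 γ) ^ 2 ≤ φ (eval 0 γ) + dist x (eval 1 γ) ^ 2} := by
    ext γ; simp [Contact, and_assoc]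
  rw [this]
  refine (isCompact_geo hB hY).inter_right ?_
  refine isClosed_iInter fun x => isClosed_iInter fun _ => isClosed_le ?_ ?_ <;> fun_prop

/-- Key inequality along a geodesic. -/
lemma contact_ineq {φ : X → ℝ} {B Y : Set X} {γ : Geo X} (hγ : γ ∈ Contact φ B Y)
    (r : unitInterval) {x : X} (hx : x ∈ B) :
    r * φ x + (r * dist (eval 0 γ) (eval 1 γ)) ^ 2 ≤
      r * φ (eval 0 γ) + dist x (eval r γ) ^ 2 := by
  have h := hγ.2.2 x hx
  have h1 := eval_dist γ r 1
  have h2 : |(r : ℝ) - ((1 : unitInterval) : ℝ)| = 1 - r := by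
    rw [abs_sub_comm, abs_of_nonneg] <;> simp [r.2.2]
  rw [h2] at h1
  have h3 := dist_triangle x (eval r γ) (eval 1 γ)
  rw [h1] at h3
  set D := dist (eval 0 γ) (eval 1 γ)
  set a := dist x (eval r γ)
  set e := dist x (eval 1 γ)
  have hr0 := r.2.1
  have hr1 := r.2.2
  have he : 0 ≤ e := dist_nonneg
  have h4 : e ^ 2 ≤ (a + (1 - r) * D) ^ 2 := pow_le_pow_left₀ he h3 2
  have h5 : (r : ℝ) * (φ x + D ^ 2) ≤ r * (φ (eval 0 γ) + (a + (1 - r) * D) ^ 2) :=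
    mul_le_mul_of_nonneg_left (by linarith) hr0
  have h6 : 0 ≤ (1 - (r : ℝ)) * (a - r * D) ^ 2 := mul_nonneg (by linarith) (sq_nonneg _)
  nlinarith

lemma restr_contact {φ : X → ℝ} {B Y Y' : Set X} {γ : Geo X} (hγ : γ ∈ Contact φ B Y)
    (r : unitInterval) (hr : eval r γ ∈ Y') :
    restr 0 r γ ∈ Contact (fun x => r * φ x) B Y' := by
  refine ⟨?_, ?_, fun x hx => ?_⟩
  · rw [eval_restr, aff_zero]; exact hγ.1
  · rw [eval_restr, aff_one]; exact hr
  · rw [eval_restr, eval_restr, aff_zero, aff_one]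
    have h := contact_ineq hγ r hx
    have h1 := eval_dist γ 0 r
    have h2 : |((0 : unitInterval) : ℝ) - (r : ℝ)| = r := by
      simp [abs_of_nonneg r.2.1]
    rw [h1, h2]
    exact h

/-- Evolved potential. -/
def Psi (φ : X → ℝ) (B : Set X) (r : ℝ) (w : X) : ℝ :=
  sInf ((fun x => dist x w ^ 2 / r - φ x) '' B)

lemma continuous_Psi {φ : X → ℝ} (hφ : Continuous φ) {B : Set X} (hB : IsCompact B) (r : ℝ) :
    Continuous (Psi φ B r) := by
  unfold Psi
  apply IsCompact.continuous_sInf (f := fun w x => dist x w ^ 2 / r - φ x) hB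
  simp only [Function.HasUncurry.uncurry, id]
  fun_prop

lemma Psi_le {φ : X → ℝ} (hφ : Continuous φ) {B : Set X} (hB : IsCompact B) (r : ℝ) (w : X)
    {x : X} (hx : x ∈ B) : Psi φ B r w ≤ dist x w ^ 2 / r - φ x := by
  apply csInf_le
  · apply (hB.image _).bddBelow
    fun_prop
  · exact ⟨x, hx, rfl⟩

lemma Psi_contact {φ : X → ℝ} (hφ : Continuous φ) {B Y : Set X} (hB : IsCompact B)
    (r : unitInterval) (hr : 0 < (r : ℝ)) {γ : Geo X} (hγ : γ ∈ Contact φ B Y) :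
    Psi φ B r (eval r γ) = r * dist (eval 0 γ) (eval 1 γ) ^ 2 - φ (eval 0 γ) := by
  apply le_antisymm
  · refine (Psi_le hφ hB r _ hγ.1).trans (le_of_eq ?_)
    rw [eval_dist γ 0 r]
    simp [abs_of_nonneg r.2.1]
    field_simp
  · apply le_csInf
    · exact ⟨_, _, hγ.1, rfl⟩
    · rintro _ ⟨x, hx, rfl⟩
      have h := contact_ineq hγ r hx
      simp only
      rw [le_sub_iff_add_le, le_div_iff₀ hr]
      nlinarith

lemma exists_pot [ProperSpace X] {φ : X → ℝ} (hφ : Continuous φ) {B Y : Set X}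
    (hB : IsCompact B) (hY : IsCompact Y) (a b : unitInterval) (hab : (a : ℝ) < b) :
    ∃ (B' Y' : Set X) (u v : X → ℝ), IsCompact B' ∧ IsCompact Y' ∧ Continuous u ∧ Continuous v ∧
      (∀ x ∈ B', ∀ y ∈ Y', u x + v y ≤ dist x y ^ 2) ∧
      ∀ γ ∈ Contact φ B Y, eval a γ ∈ B' ∧ eval b γ ∈ Y' ∧
        u (eval a γ) + v (eval b γ) = dist (eval a γ) (eval b γ) ^ 2 := by
  have hC := isCompact_contact hφ hB hY
  have ha0 := a.2.1
  have hb0 : 0 < (b : ℝ) := lt_of_le_of_lt ha0 hab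
  refine ⟨eval a '' Contact φ B Y, eval b '' Contact φ B Y,
    if (a : ℝ) = 0 then fun z => (b - a) * φ z else fun z => - ((b - a) * Psi φ B a z),
    fun w => (b - a) * Psi φ B b w, hC.image (continuous_geval a), hC.image (continuous_geval b),
    ?_, ?_, ?_, ?_⟩
  · have := continuous_Psi hφ hB (a : ℝ)
    split_ifs <;> fun_prop
  · have := continuous_Psi hφ hB (b : ℝ)
    fun_prop
  · rintro z ⟨α, hα, rfl⟩ w ⟨β, hβ, rfl⟩
    split_ifs with h0
    · have : a = 0 := Subtype.ext h0
      subst this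
      have h := Psi_le hφ hB b (eval b β) hα.1
      have h2 := mul_le_mul_of_nonneg_left h hb0.le
      rw [mul_sub, mul_div_cancel₀ _ hb0.ne'] at h2
      simp only [Set.Icc.coe_zero, sub_zero]
      linarith
    · have ha : 0 < (a : ℝ) := lt_of_le_of_ne ha0 (Ne.symm h0)
      have h3 : Psi φ B b (eval b β) - dist (eval a α) (eval b β) ^ 2 / (b - a) ≤
          Psi φ B a (eval a α) := by
        apply le_csInf
        · exact ⟨_, _, hα.1, rfl⟩
        · rintro _ ⟨x, hx, rfl⟩
          have h := Psi_le hφ hB b (eval b β) hx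
          have ht := dist_triangle x (eval a α) (eval b β)
          simp only
          set p := dist x (eval a α)
          set q := dist (eval a α) (eval b β)
          set e := dist x (eval b β)
          have he : 0 ≤ e := dist_nonneg
          have h4 : e ^ 2 ≤ (p + q) ^ 2 := pow_le_pow_left₀ he ht 2
          have hba : 0 < (b : ℝ) - a := sub_pos.2 hab
          have h5 : e ^ 2 / b ≤ p ^ 2 / a + q ^ 2 / (b - a) := by
            rw [div_add_div _ _ ha.ne' hba.ne', div_le_div_iff₀ hb0 (by positivity)]
            have h6 := mul_le_mul_of_nonneg_right h4 (mul_pos ha hba).le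
            nlinarith [sq_nonneg (p * (b - a) - q * a)]
          linarith
      have hba : 0 < (b : ℝ) - a := sub_pos.2 hab
      have h4 := mul_le_mul_of_nonneg_left h3 hba.le
      rw [mul_sub, mul_div_cancel₀ _ hba.ne'] at h4
      linarith
  · intro γ hγ
    refine ⟨⟨γ, hγ, rfl⟩, ⟨γ, hγ, rfl⟩, ?_⟩
    have h1 := Psi_contact hφ hB b hb0 hγ
    simp only [h1]
    rw [eval_dist γ a b, abs_sub_comm, abs_of_pos (sub_pos.2 hab)]
    split_ifs with h0
    · have : a = 0 := Subtype.ext h0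
      subst this
      simp only [Set.Icc.coe_zero, sub_zero]
      ring
    · have ha : 0 < (a : ℝ) := lt_of_le_of_ne ha0 (Ne.symm h0)
      have h2 := Psi_contact hφ hB a ha hγ
      simp only [h2]
      ring

lemma sinh_sub_le {y : ℝ} (hy : 0 ≤ y) {t : ℝ} (ht0 : 0 ≤ t) (ht1 : t ≤ 1) :
    Real.sinh y - Real.sinh (t * y) ≤ (1 - t) * y * Real.cosh y := by
  have hty : t * y ≤ y := by nlinarith
  have h0 : 0 ≤ t * y := mul_nonneg ht0 hy
  have h := Convex.image_sub_le_mul_sub_of_deriv_le (convex_Icc 0 y) (f := Real.sinh)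
    (Real.continuous_sinh.continuousOn) (Real.differentiable_sinh.differentiableOn)
    (C := Real.cosh y) (by
      intro x hx
      rw [interior_Icc] at hx
      rw [Real.deriv_sinh]
      apply Real.cosh_le_cosh.2
      rw [abs_of_pos hx.1, abs_of_nonneg hy]
      exact hx.2.le) (t * y) ⟨h0, hty⟩ y ⟨hy, le_rfl⟩ hty
  nlinarith

lemma sigma_lower {K N t θ L : ℝ} (hN : 0 < N) (ht0 : 0 ≤ t) (ht1 : t ≤ 1) (hθ : 0 ≤ θ)
    (hL : θ ≤ L) :
    ENNReal.ofReal (t / Real.cosh (L * Real.sqrt (-K / N))) ≤ sigmaCoeff K N t θ ∧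
    ENNReal.ofReal (1 - (1 - t) * Real.cosh (L * Real.sqrt (-K / N))) ≤ sigmaCoeff K N t θ := by
  have hc := Real.one_le_cosh (L * Real.sqrt (-K / N))
  have q1 : t / Real.cosh (L * Real.sqrt (-K / N)) ≤ t := div_le_self ht0 hc
  have q2 : 1 - (1 - t) * Real.cosh (L * Real.sqrt (-K / N)) ≤ t := by nlinarith
  unfold sigmaCoeff
  split_ifs with h1 h2 h3
  · simp
  · have key : t ≤ Real.sin (t * θ * Real.sqrt (K / N)) / Real.sin (θ * Real.sqrt (K / N)) := by
      push Not at h1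
      have hθ' : 0 < θ := lt_of_le_of_ne hθ (by rintro rfl; simp at h2)
      have hK : 0 < K := by
        by_contra hK
        push Not at hK
        nlinarith [sq_nonneg θ]
      have hs : 0 < Real.sqrt (K / N) := Real.sqrt_pos.2 (by positivity)
      have hs2 : Real.sqrt (K / N) ^ 2 = K / N := Real.sq_sqrt (by positivity)
      have hx0 : 0 < θ * Real.sqrt (K / N) := by positivity
      have hxpi : θ * Real.sqrt (K / N) < Real.pi := by
        apply lt_of_pow_lt_pow_left₀ 2 Real.pi_pos.le
        rw [mul_pow, hs2, ← mul_div_assoc, div_lt_iff₀ hN]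
        linarith
      have hsin : 0 < Real.sin (θ * Real.sqrt (K / N)) := Real.sin_pos_of_pos_of_lt_pi hx0 hxpi
      rw [le_div_iff₀ hsin]
      have := strictConcaveOn_sin_Icc.concaveOn.2 (x := 0) ⟨le_rfl, Real.pi_pos.le⟩
        (y := θ * Real.sqrt (K / N)) ⟨hx0.le, hxpi.le⟩ (sub_nonneg.2 ht1) ht0 (by ring)
      simp only [smul_eq_mul, Real.sin_zero, mul_zero, zero_add] at this
      rw [mul_assoc]
      exact this
    exact ⟨ENNReal.ofReal_le_ofReal (q1.trans key), ENNReal.ofReal_le_ofReal (q2.trans key)⟩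
  · exact ⟨ENNReal.ofReal_le_ofReal q1, ENNReal.ofReal_le_ofReal q2⟩
  · have hθ' : 0 < θ := lt_of_le_of_ne hθ (by rintro rfl; simp at h3)
    have hK : K < 0 := by
      by_contra hK
      push Not at hK
      rcases hK.eq_or_lt with hK | hK
      · apply h3; simp [← hK]
      · apply h2; positivity
    have hs : 0 < Real.sqrt (-K / N) := Real.sqrt_pos.2 (div_pos (by linarith) hN)
    set s := Real.sqrt (-K / N)
    have hy : 0 < θ * s := by positivity
    have hyL : θ * s ≤ L * s := by nlinarith
    have hcc : Real.cosh (θ * s) ≤ Real.cosh (L * s) := by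
      apply Real.cosh_le_cosh.2
      rw [abs_of_pos hy, abs_of_pos (by linarith)]
      exact hyL
    have hsh : 0 < Real.sinh (θ * s) := Real.sinh_pos_iff.2 hy
    have hsy : θ * s ≤ Real.sinh (θ * s) := Real.self_le_sinh_iff.2 hy.le
    have hsty : t * θ * s ≤ Real.sinh (t * θ * s) := Real.self_le_sinh_iff.2 (by positivity)
    have e1 := sinh_sub_le hy.le (le_refl (0 : ℝ)) zero_le_one
    have e2 := sinh_sub_le hy.le ht0 ht1
    simp only [zero_mul, Real.sinh_zero, sub_zero, one_mul] at e1
    rw [← mul_assoc] at e2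
    set C := Real.cosh (θ * s)
    set CL := Real.cosh (L * s)
    set S := Real.sinh (θ * s)
    constructor
    · apply ENNReal.ofReal_le_ofReal
      rw [div_le_div_iff₀ (by linarith) hsh]
      have a1 : t * S ≤ t * (θ * s * C) := mul_le_mul_of_nonneg_left e1 ht0
      have a2 : t * θ * s * C ≤ t * θ * s * CL := mul_le_mul_of_nonneg_left hcc (by positivity)
      have a3 : t * θ * s * CL ≤ Real.sinh (t * θ * s) * CL :=
        mul_le_mul_of_nonneg_right hsty (by linarith)
      nlinarith
    · apply ENNReal.ofReal_le_ofReal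
      rw [le_div_iff₀ hsh]
      have a1 : (1 - t) * (θ * s) * C ≤ (1 - t) * S * C :=
        mul_le_mul_of_nonneg_right (mul_le_mul_of_nonneg_left hsy (by linarith))
          (le_trans zero_le_one (Real.one_le_cosh _))
      have a2 : (1 - t) * S * C ≤ (1 - t) * S * CL :=
        mul_le_mul_of_nonneg_left hcc (mul_nonneg (by linarith) hsh.le)
      nlinarith

lemma sigma_pos (K : ℝ) {N : ℝ} (hN : 0 < N) {t : ℝ} (ht0 : 0 < t) (ht1 : t ≤ 1) (L : ℝ) :
    ∃ c : ℝ≥0∞, c ≠ 0 ∧ c ≠ ⊤ ∧ ∀ θ, 0 ≤ θ → θ ≤ L → c ≤ sigmaCoeff K N t θ := by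
  refine ⟨ENNReal.ofReal (t / Real.cosh (L * Real.sqrt (-K / N))), ?_, ENNReal.ofReal_ne_top,
    fun θ h1 h2 => (sigma_lower hN ht0.le ht1 h1 h2).1⟩
  rw [ne_eq, ENNReal.ofReal_eq_zero, not_le]
  have := Real.cosh_pos (L * Real.sqrt (-K / N))
  positivity

lemma sigma_near (K : ℝ) {N : ℝ} (hN : 0 < N) {c : ℝ} (hc : c < 1) (L : ℝ) :
    ∃ l0 : ℝ, 0 < l0 ∧ ∀ t, 0 ≤ t → t ≤ 1 → 1 - l0 ≤ t → ∀ θ, 0 ≤ θ → θ ≤ L →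
      ENNReal.ofReal c ≤ sigmaCoeff K N t θ := by
  have hp := Real.cosh_pos (L * Real.sqrt (-K / N))
  refine ⟨(1 - c) / Real.cosh (L * Real.sqrt (-K / N)), div_pos (by linarith) hp,
    fun t h0 h1 ht θ h2 h3 => le_trans (ENNReal.ofReal_le_ofReal ?_) (sigma_lower hN h0 h1 h2 h3).2⟩
  have : 1 - t ≤ (1 - c) / Real.cosh (L * Real.sqrt (-K / N)) := by linarith
  rw [le_div_iff₀ hp] at this
  linarith

/-- Entropy functional. -/
def Fp {Y : Type*} [MeasurableSpace Y] (p : ℝ) (m μ : Measure Y) : ℝ≥0∞ :=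
  ∫⁻ x, (μ.rnDeriv m x) ^ p ∂m

section Fp
variable {Y : Type*} [MeasurableSpace Y] {m : Measure Y} [SigmaFinite m] {p : ℝ}

lemma Fp_cond (hp0 : 0 < p) (hp1 : p < 1) {G : Set Y} (hG : MeasurableSet G) (h0 : m G ≠ 0)
    (h1 : m G ≠ ⊤) : Fp p m (ProbabilityTheory.cond m G) = m G ^ (1 - p) := by
  have e : ProbabilityTheory.cond m G = m.withDensity (G.indicator fun _ => (m G)⁻¹) := by
    rw [withDensity_indicator hG, withDensity_const]
    rfl
  have hmeas : Measurable (G.indicator fun _ => (m G)⁻¹ : Y → ℝ≥0∞) :=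
    measurable_const.indicator hG
  have h2 : ∫⁻ x, ((ProbabilityTheory.cond m G).rnDeriv m x) ^ p ∂m =
      ∫⁻ x, G.indicator (fun _ => ((m G)⁻¹) ^ p) x ∂m := by
    apply lintegral_congr_ae
    rw [e]
    filter_upwards [Measure.rnDeriv_withDensity m hmeas] with x hx
    rw [hx]
    by_cases hxG : x ∈ G <;> simp [hxG, hp0]
  rw [Fp, h2, lintegral_indicator_const hG, ENNReal.inv_rpow, ← ENNReal.rpow_neg,
    ENNReal.rpow_sub _ _ h0 h1, ENNReal.rpow_one, ENNReal.rpow_neg, div_eq_mul_inv, mul_comm]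

lemma Fp_restrict (hp0 : 0 < p) {μ : Measure Y} {S : Set Y} (hS : MeasurableSet S)
    (h : μ Sᶜ = 0) : Fp p m μ = ∫⁻ x in S, (μ.rnDeriv m x) ^ p ∂m := by
  have hz : ∀ᵐ x ∂(m.restrict Sᶜ), μ.rnDeriv m x = 0 := by
    have : ∫⁻ x in Sᶜ, μ.rnDeriv m x ∂m = 0 :=
      le_antisymm ((Measure.setLIntegral_rnDeriv_le _).trans h.le) bot_le
    rw [lintegral_eq_zero_iff (Measure.measurable_rnDeriv _ _)] at this
    exact this
  rw [Fp, ← lintegral_add_compl _ hS]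
  have : ∫⁻ x in Sᶜ, (μ.rnDeriv m x) ^ p ∂m = 0 := by
    rw [lintegral_eq_zero_iff ((Measure.measurable_rnDeriv _ _).pow_const _)]
    filter_upwards [hz] with x hx
    simp [hx, hp0]
  rw [this, add_zero]

lemma Fp_le (hp0 : 0 < p) (hp1 : p < 1) {μ : Measure Y} (hμ : μ univ ≤ 1) {S : Set Y}
    (hS : MeasurableSet S) (h : μ Sᶜ = 0) : Fp p m μ ≤ m S ^ (1 - p) := by
  rw [Fp_restrict hp0 hS h]
  have h2 := ENNReal.lintegral_mul_norm_pow_le (μ := m.restrict S) (f := μ.rnDeriv m)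
    (g := fun _ => 1) (p := p) (q := 1 - p) (Measure.measurable_rnDeriv _ _).aemeasurable
    aemeasurable_const hp0.le (by linarith) (by ring)
  simp only [ENNReal.one_rpow, mul_one, lintegral_const, one_mul, Measure.restrict_apply_univ]
    at h2
  refine h2.trans ?_
  have : (∫⁻ x in S, μ.rnDeriv m x ∂m) ^ p ≤ 1 := by
    apply ENNReal.rpow_le_one _ hp0.le
    exact (Measure.setLIntegral_rnDeriv_le _).trans ((measure_mono (subset_univ _)).trans hμ)
  calc _ ≤ 1 * m S ^ (1 - p) := by gcongr
    _ = _ := one_mul _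

lemma Fp_pos (hp0 : 0 < p) {μ : Measure Y} [IsFiniteMeasure μ] (hμ : μ ≪ m) (h0 : μ ≠ 0) :
    Fp p m μ ≠ 0 := by
  intro h
  rw [Fp, lintegral_eq_zero_iff ((Measure.measurable_rnDeriv _ _).pow_const _)] at h
  apply h0
  rw [← Measure.withDensity_rnDeriv_eq μ m hμ, withDensity_eq_zero_iff
    (Measure.measurable_rnDeriv _ _).aemeasurable]
  filter_upwards [h] with x hx
  simpa [hp0.le, hp0, not_lt.2 hp0.le] using hx

lemma Fp_mix (hp0 : 0 < p) {μ1 μ2 : Measure Y} [IsFiniteMeasure μ1] [IsFiniteMeasure μ2]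
    {A : Set Y} (hA : MeasurableSet A) (h1 : μ1 Aᶜ = 0) (h2 : μ2 A = 0) :
    (2⁻¹ : ℝ≥0∞) ^ p * (Fp p m μ1 + Fp p m μ2) ≤ Fp p m ((2⁻¹ : ℝ≥0∞) • (μ1 + μ2)) := by
  rw [Fp_restrict hp0 hA h1, Fp_restrict hp0 hA.compl (by rwa [compl_compl]), Fp,
    ← lintegral_add_compl (fun x => ((2⁻¹ : ℝ≥0∞) • (μ1 + μ2)).rnDeriv m x ^ p) hA, mul_add,
    ← lintegral_const_mul _ ((Measure.measurable_rnDeriv _ _).pow_const _),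
    ← lintegral_const_mul _ ((Measure.measurable_rnDeriv _ _).pow_const _)]
  have e : ((2⁻¹ : ℝ≥0∞) • (μ1 + μ2)).rnDeriv m =ᵐ[m]
      fun x => 2⁻¹ * (μ1.rnDeriv m x + μ2.rnDeriv m x) := by
    have a1 := Measure.rnDeriv_smul_left_of_ne_top (μ1 + μ2) m (r := 2⁻¹) (by simp)
    have a2 := Measure.rnDeriv_add μ1 μ2 m
    filter_upwards [a1, a2] with x hx hy
    rw [hx, Pi.smul_apply, hy]
    simp
  apply add_le_add
  · apply lintegral_mono_ae
    filter_upwards [ae_restrict_of_ae e] with x hx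
    rw [hx, ← ENNReal.mul_rpow_of_nonneg _ _ hp0.le]
    gcongr
    exact le_self_add
  · apply lintegral_mono_ae
    filter_upwards [ae_restrict_of_ae e] with x hx
    rw [hx, ← ENNReal.mul_rpow_of_nonneg _ _ hp0.le]
    gcongr
    exact le_add_self

lemma lintegral_rnDeriv_rpow {q : ℝ} (hq0 : 0 < q) (hq1 : q < 1) {μ : Measure Y}
    [IsFiniteMeasure μ] (hμ : μ ≪ m) :
    ∫⁻ x, (μ.rnDeriv m x) ^ (-q) ∂μ = Fp (1 - q) m μ := by
  have hm := Measure.measurable_rnDeriv μ m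
  conv_lhs => rw [← Measure.withDensity_rnDeriv_eq μ m hμ]
  rw [lintegral_withDensity_eq_lintegral_mul _ hm (by
    rw [Measure.withDensity_rnDeriv_eq μ m hμ]; exact hm.pow_const _)]
  rw [Measure.withDensity_rnDeriv_eq μ m hμ]
  apply lintegral_congr_ae
  filter_upwards [Measure.rnDeriv_lt_top μ m] with x hx
  rw [Pi.mul_apply]
  by_cases h0 : μ.rnDeriv m x = 0
  · rw [h0, zero_mul, ENNReal.zero_rpow_of_pos (by linarith)]
  · rw [sub_eq_add_neg, ENNReal.rpow_add _ _ h0 hx.ne, ENNReal.rpow_one]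

end Fp

/-- The inequality of `CD*` for a plan, with exponent `N+1`. -/
def CDplan (K N : ℝ) (m : Measure X) (π : Measure (Geo X)) : Prop :=
  ∀ t : unitInterval,
        ∫⁻ γ, (sigmaCoeff K (N + 1) (1 - (t : ℝ)) (dist (eval 0 γ) (eval 1 γ)) *
                 ((π.map (eval 0)).rnDeriv m (eval 0 γ)) ^ (-(1 / (N + 1))) +
               sigmaCoeff K (N + 1) (t : ℝ) (dist (eval 0 γ) (eval 1 γ)) *
                 ((π.map (eval 1)).rnDeriv m (eval 1 γ)) ^ (-(1 / (N + 1)))) ∂π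
          ≤ Fp (1 - 1 / (N + 1)) m (π.map (eval t))

lemma cd_ineq_left [BorelSpace X] {K N : ℝ} (hN : 1 ≤ N) {m : Measure X} [SigmaFinite m]
    {π : Measure (Geo X)} [IsFiniteMeasure π] (h : CDplan K N m π) (t : unitInterval)
    {c : ℝ≥0∞} (hc : ∀ᵐ γ ∂π, c ≤ sigmaCoeff K (N + 1) (1 - (t : ℝ)) (dist (eval 0 γ) (eval 1 γ)))
    (hac : π.map (eval 0) ≪ m) :
    c * Fp (1 - 1 / (N + 1)) m (π.map (eval 0)) ≤ Fp (1 - 1 / (N + 1)) m (π.map (eval t)) := by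
  refine le_trans ?_ (h t)
  have hq0 : 0 < 1 / (N + 1) := by positivity
  have hq1 : 1 / (N + 1) < 1 := by rw [div_lt_one] <;> linarith
  have hm := (Measure.measurable_rnDeriv (π.map (eval 0)) m).pow_const (-(1 / (N + 1)))
  have hm2 : Measurable fun γ : Geo X =>
      (π.map (eval 0)).rnDeriv m (eval 0 γ) ^ (-(1 / (N + 1))) := hm.comp (measurable_geval 0)
  rw [← lintegral_rnDeriv_rpow hq0 hq1 hac, lintegral_map hm (measurable_geval 0),
    ← lintegral_const_mul _ hm2]
  apply lintegral_mono_ae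
  filter_upwards [hc] with γ hγ
  exact le_trans (mul_le_mul_left hγ _) le_self_add

lemma cd_ineq_right [BorelSpace X] {K N : ℝ} (hN : 1 ≤ N) {m : Measure X} [SigmaFinite m]
    {π : Measure (Geo X)} [IsFiniteMeasure π] (h : CDplan K N m π) (t : unitInterval)
    {c : ℝ≥0∞} (hc : ∀ᵐ γ ∂π, c ≤ sigmaCoeff K (N + 1) (t : ℝ) (dist (eval 0 γ) (eval 1 γ)))
    (hac : π.map (eval 1) ≪ m) :
    c * Fp (1 - 1 / (N + 1)) m (π.map (eval 1)) ≤ Fp (1 - 1 / (N + 1)) m (π.map (eval t)) := by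
  refine le_trans ?_ (h t)
  have hq0 : 0 < 1 / (N + 1) := by positivity
  have hq1 : 1 / (N + 1) < 1 := by rw [div_lt_one] <;> linarith
  have hm := (Measure.measurable_rnDeriv (π.map (eval 1)) m).pow_const (-(1 / (N + 1)))
  have hm2 : Measurable fun γ : Geo X =>
      (π.map (eval 1)).rnDeriv m (eval 1 γ) ^ (-(1 / (N + 1))) := hm.comp (measurable_geval 1)
  rw [← lintegral_rnDeriv_rpow hq0 hq1 hac, lintegral_map hm (measurable_geval 1),
    ← lintegral_const_mul _ hm2]
  apply lintegral_mono_ae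
  filter_upwards [hc] with γ hγ
  exact le_trans (mul_le_mul_left hγ _) le_add_self

lemma cd_exists {K N : ℝ} {m : Measure X} (hCD : IsCDStar K N m) {μ0 μ1 : Measure X}
    (h0 : IsProbabilityMeasure μ0) (h1 : IsProbabilityMeasure μ1)
    (hb : ∃ s : Set X, Bornology.IsBounded s ∧ μ0 sᶜ = 0 ∧ μ1 sᶜ = 0) :
    ∃ π, IsOptGeo μ0 μ1 π ∧ CDplan K N m π := by
  obtain ⟨π, h2, h3⟩ := hCD μ0 μ1 h0 h1 hb
  exact ⟨π, h2, fun t => h3 t (N + 1) (by linarith)⟩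

section Opt
variable [TopologicalSpace.SeparableSpace X] [BorelSpace X]

lemma cont_int {B Y : Set X} (hB : IsCompact B) {u : X → ℝ} (hu : Continuous u)
    {π : Measure (Geo X)} [IsFiniteMeasure π] (t : unitInterval) (h : ∀ᵐ γ ∂π, eval t γ ∈ B) :
    Integrable (fun γ => u (eval t γ)) π := by
  obtain ⟨C, hC⟩ := hB.exists_bound_of_continuousOn hu.continuousOn
  refine Integrable.of_bound (C := C) (hu.comp (continuous_geval t)).aestronglyMeasurable ?_
  filter_upwards [h] with γ hγ using hC _ hγ

lemma dist_int {B Y : Set X} (hB : IsCompact B) (hY : IsCompact Y)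
    {π : Measure (Geo X)} [IsFiniteMeasure π] (h : ∀ᵐ γ ∂π, eval 0 γ ∈ B ∧ eval 1 γ ∈ Y) :
    Integrable (fun γ : Geo X => dist (eval 0 γ) (eval 1 γ) ^ 2) π := by
  obtain ⟨D, hD0, hD⟩ := exists_dist_bound hB hY
  have h0 := continuous_geval (X := X) 0
  have h1 := continuous_geval (X := X) 1
  refine Integrable.of_bound (C := D ^ 2) ?_ ?_
  · exact Continuous.aestronglyMeasurable (by fun_prop)
  · filter_upwards [h] with γ hγ
    rw [Real.norm_of_nonneg (by positivity)]
    exact pow_le_pow_left₀ dist_nonneg (hD _ hγ.1 _ hγ.2) 2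

lemma cost_eq {B Y : Set X} (hB : IsCompact B) (hY : IsCompact Y)
    {π : Measure (Geo X)} [IsFiniteMeasure π] (h : ∀ᵐ γ ∂π, eval 0 γ ∈ B ∧ eval 1 γ ∈ Y) :
    transportCost π = ENNReal.ofReal (∫ γ, dist (eval 0 γ) (eval 1 γ) ^ 2 ∂π) := by
  rw [ofReal_integral_eq_lintegral_ofReal (dist_int hB hY h)
    (Filter.Eventually.of_forall fun γ => by positivity)]
  rfl

lemma ae_of_map_eq {π π' : Measure (Geo X)} {t : unitInterval} {B : Set X} (hB : MeasurableSet B)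
    (he : π'.map (eval t) = π.map (eval t)) (h : ∀ᵐ γ ∂π, eval t γ ∈ B) :
    ∀ᵐ γ ∂π', eval t γ ∈ B := by
  have h1 : ∀ᵐ x ∂(π.map (eval t)), x ∈ B :=
    (ae_map_iff (measurable_geval t).aemeasurable hB).2 h
  rw [← he] at h1
  exact (ae_map_iff (measurable_geval t).aemeasurable hB).1 h1

lemma pot_compare {B Y : Set X} (hB : IsCompact B) (hY : IsCompact Y) {u v : X → ℝ}
    (hu : Continuous u) (hv : Continuous v) (hle : ∀ x ∈ B, ∀ y ∈ Y, u x + v y ≤ dist x y ^ 2)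
    {π : Measure (Geo X)} [IsProbabilityMeasure π]
    (hπ : ∀ᵐ γ ∂π, eval 0 γ ∈ B ∧ eval 1 γ ∈ Y ∧
      u (eval 0 γ) + v (eval 1 γ) = dist (eval 0 γ) (eval 1 γ) ^ 2)
    {π' : Measure (Geo X)} [IsProbabilityMeasure π']
    (h0 : π'.map (eval 0) = π.map (eval 0)) (h1 : π'.map (eval 1) = π.map (eval 1)) :
    transportCost π ≤ transportCost π' ∧ (transportCost π' ≤ transportCost π →
      ∀ᵐ γ ∂π', eval 0 γ ∈ B ∧ eval 1 γ ∈ Y ∧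
      u (eval 0 γ) + v (eval 1 γ) = dist (eval 0 γ) (eval 1 γ) ^ 2) := by
  have a0 : ∀ᵐ γ ∂π, eval 0 γ ∈ B := by filter_upwards [hπ] with γ h using h.1
  have a1 : ∀ᵐ γ ∂π, eval 1 γ ∈ Y := by filter_upwards [hπ] with γ h using h.2.1
  have b0 := ae_of_map_eq hB.measurableSet h0 a0
  have b1 := ae_of_map_eq hY.measurableSet h1 a1
  rw [cost_eq hB hY (a0.and a1), cost_eq hB hY (b0.and b1)]
  have d1 := dist_int hB hY (a0.and a1)
  have d2 := dist_int hB hY (b0.and b1)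
  have iu := cont_int (Y := Y) hB hu 0 a0
  have iv := cont_int (Y := Y) hY hv 1 a1
  have iu' := cont_int (Y := Y) hB hu 0 b0
  have iv' := cont_int (Y := Y) hY hv 1 b1
  have eu : ∫ γ, u (eval 0 γ) ∂π' = ∫ γ, u (eval 0 γ) ∂π := by
    rw [← integral_map (measurable_geval 0).aemeasurable hu.aestronglyMeasurable,
      ← integral_map (measurable_geval 0).aemeasurable hu.aestronglyMeasurable, h0]
  have ev : ∫ γ, v (eval 1 γ) ∂π' = ∫ γ, v (eval 1 γ) ∂π := by
    rw [← integral_map (measurable_geval 1).aemeasurable hv.aestronglyMeasurable,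
      ← integral_map (measurable_geval 1).aemeasurable hv.aestronglyMeasurable, h1]
  have e1 : ∫ γ, dist (eval 0 γ) (eval 1 γ) ^ 2 ∂π = ∫ γ, (u (eval 0 γ) + v (eval 1 γ)) ∂π' := by
    rw [integral_add iu' iv', eu, ev, ← integral_add iu iv]
    apply integral_congr_ae
    filter_upwards [hπ] with γ h using h.2.2.symm
  have hae : ∀ᵐ γ ∂π', u (eval 0 γ) + v (eval 1 γ) ≤ dist (eval 0 γ) (eval 1 γ) ^ 2 := by
    filter_upwards [b0, b1] with γ g0 g1 using hle _ g0 _ g1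
  have hcmp : ∫ γ, dist (eval 0 γ) (eval 1 γ) ^ 2 ∂π ≤ ∫ γ, dist (eval 0 γ) (eval 1 γ) ^ 2 ∂π' := by
    rw [e1]
    exact integral_mono_ae (iu'.add iv') d2 hae
  refine ⟨ENNReal.ofReal_le_ofReal hcmp, fun h => ?_⟩
  rw [ENNReal.ofReal_le_ofReal_iff (integral_nonneg fun γ => by positivity), e1] at h
  have heq := (integral_eq_iff_of_ae_le (iu'.add iv') d2 hae).1
    (le_antisymm (integral_mono_ae (iu'.add iv') d2 hae) h)
  filter_upwards [b0, b1, heq] with γ g0 g1 g2 using ⟨g0, g1, g2⟩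

lemma opt_of_pot {B Y : Set X} (hB : IsCompact B) (hY : IsCompact Y) {u v : X → ℝ}
    (hu : Continuous u) (hv : Continuous v) (hle : ∀ x ∈ B, ∀ y ∈ Y, u x + v y ≤ dist x y ^ 2)
    {π : Measure (Geo X)} (hp : IsProbabilityMeasure π)
    (hπ : ∀ᵐ γ ∂π, eval 0 γ ∈ B ∧ eval 1 γ ∈ Y ∧
      u (eval 0 γ) + v (eval 1 γ) = dist (eval 0 γ) (eval 1 γ) ^ 2) :
    IsOptGeo (π.map (eval 0)) (π.map (eval 1)) π :=
  ⟨hp, rfl, rfl, fun π' hp' h0 h1 => (pot_compare hB hY hu hv hle hπ h0 h1).1⟩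

lemma pot_of_opt {B Y : Set X} (hB : IsCompact B) (hY : IsCompact Y) {u v : X → ℝ}
    (hu : Continuous u) (hv : Continuous v) (hle : ∀ x ∈ B, ∀ y ∈ Y, u x + v y ≤ dist x y ^ 2)
    {π : Measure (Geo X)} (hp : IsProbabilityMeasure π)
    (hπ : ∀ᵐ γ ∂π, eval 0 γ ∈ B ∧ eval 1 γ ∈ Y ∧
      u (eval 0 γ) + v (eval 1 γ) = dist (eval 0 γ) (eval 1 γ) ^ 2)
    {π' : Measure (Geo X)} (h' : IsOptGeo (π.map (eval 0)) (π.map (eval 1)) π') :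
    ∀ᵐ γ ∂π', eval 0 γ ∈ B ∧ eval 1 γ ∈ Y ∧
      u (eval 0 γ) + v (eval 1 γ) = dist (eval 0 γ) (eval 1 γ) ^ 2 := by
  obtain ⟨hp', h0, h1, h2⟩ := h'
  exact (pot_compare hB hY hu hv hle hπ h0 h1).2 (h2 π hp rfl rfl)

end Opt

lemma exists_selection [BorelSpace X] {K : Set (Geo X)} (hK : IsCompact K) (hne : K.Nonempty) :
    ∃ s : X → Geo X, Measurable s ∧ ∀ x ∈ eval 0 '' K, s x ∈ K ∧ eval 0 (s x) = x := by
  have : CompactSpace K := isCompact_iff_compactSpace.1 hK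
  have : Nonempty K := hne.to_subtype
  obtain ⟨f, hf, hsurj⟩ := exists_nat_bool_continuous_surjective_of_compact K
  let h := cantorSetHomeomorphNatToBool
  have hfh : Continuous fun z : cantorSet => ((f (h z) : K) : Geo X) :=
    continuous_subtype_val.comp (hf.comp h.continuous)
  let g : cantorSet → X := fun z => eval 0 ((f (h z) : K) : Geo X)
  have hg : Continuous g := (continuous_geval 0).comp hfh
  have : CompactSpace cantorSet := isCompact_iff_compactSpace.1 isCompact_cantorSet
  have hgr : range g = eval 0 '' K := by
    ext x
    constructor
    · rintro ⟨z, rfl⟩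
      exact ⟨_, (f (h z)).2, rfl⟩
    · rintro ⟨γ, hγ, rfl⟩
      obtain ⟨w, hw⟩ := hsurj ⟨γ, hγ⟩
      refine ⟨h.symm w, ?_⟩
      simp [g, hw]
  let c : X → ℝ := fun x => sInf (Subtype.val '' (g ⁻¹' {x}))
  have hcomp : ∀ x, IsCompact (Subtype.val '' (g ⁻¹' {x})) := fun x =>
    ((isClosed_singleton.preimage hg).isCompact).image continuous_subtype_val
  have hmem : ∀ x ∈ range g, c x ∈ Subtype.val '' (g ⁻¹' {x}) := by
    rintro x ⟨z, hz⟩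
    exact (hcomp x).sInf_mem ⟨z, z, hz, rfl⟩
  have hc0 : ∀ x, x ∉ range g → c x = 0 := by
    intro x hx
    have : g ⁻¹' {x} = ∅ := by
      ext z
      simp only [mem_preimage, mem_singleton_iff, mem_empty_iff_false, iff_false]
      exact fun hz => hx ⟨z, hz⟩
    simp [c, this]
  have hcC : ∀ x, c x ∈ cantorSet := by
    intro x
    by_cases hx : x ∈ range g
    · obtain ⟨z, _, hz⟩ := hmem x hx
      rw [← hz]; exact z.2
    · rw [hc0 x hx]; exact zero_mem_cantorSet
  have hrm : MeasurableSet (range g) := (isCompact_range hg).measurableSet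
  have hcm : Measurable c := by
    apply measurable_of_Iic
    intro a
    have e : c ⁻¹' Iic a = g '' {z | (z : ℝ) ≤ a} ∪ ((range g)ᶜ ∩ {x | 0 ≤ a}) := by
      ext x
      by_cases hx : x ∈ range g
      · simp only [mem_preimage, mem_Iic, mem_union, mem_inter_iff, mem_compl_iff, hx, not_true,
          false_and, or_false]
        constructor
        · intro hxa
          obtain ⟨z, hz, hz2⟩ := hmem x hx
          exact ⟨z, by rw [mem_ofPred_eq, hz2]; exact hxa, hz⟩
        · rintro ⟨z, hz, hz2⟩
          exact (csInf_le (hcomp x).bddBelow ⟨z, hz2, rfl⟩).trans hz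
      · simp only [mem_preimage, mem_Iic, mem_union, mem_inter_iff, mem_compl_iff, hx,
          not_false_eq_true, true_and, hc0 x hx, mem_ofPred_eq]
        constructor
        · exact fun h => Or.inr h
        · rintro (⟨z, -, hz⟩ | h)
          · exact absurd ⟨z, hz⟩ hx
          · exact h
    rw [e]
    refine MeasurableSet.union ?_ (hrm.compl.inter (MeasurableSet.const _))
    have : IsClosed {z : cantorSet | (z : ℝ) ≤ a} := isClosed_le continuous_subtype_val
      continuous_const
    exact (this.isCompact.image hg).measurableSet
  refine ⟨fun x => ((f (h ⟨c x, hcC x⟩) : K) : Geo X),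
    hfh.measurable.comp (hcm.subtype_mk (h := hcC)), ?_⟩
  intro x hx
  refine ⟨Subtype.coe_prop _, ?_⟩
  rw [← hgr] at hx
  obtain ⟨z, hz, hz2⟩ := hmem x hx
  have : (⟨c x, hcC x⟩ : cantorSet) = z := Subtype.ext hz2.symm
  simp only [this]
  exact hz

lemma map_withDensity_comp [BorelSpace X] (π : Measure (Geo X)) (t : unitInterval) {h : X → ℝ≥0∞}
    (hh : Measurable h) :
    (π.withDensity (fun γ => h (eval t γ))).map (eval t) = (π.map (eval t)).withDensity h := by
  ext S hS
  rw [Measure.map_apply (measurable_geval t) hS, withDensity_apply _ hS,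
    withDensity_apply _ (measurable_geval t hS), setLIntegral_map hS hh (measurable_geval t)]

lemma reweight [BorelSpace X] {m : Measure X} [SigmaFinite m] {π : Measure (Geo X)}
    [IsFiniteMeasure π] (t : unitInterval) (hac : π.map (eval t) ≪ m) {G : Set X}
    (hG : MeasurableSet G) (h0 : m G ≠ 0) (h1 : m G ≠ ⊤)
    (hG0 : ∀ x ∈ G, (π.map (eval t)).rnDeriv m x ≠ 0)
    (hG1 : ∀ x ∈ G, (π.map (eval t)).rnDeriv m x ≠ ⊤) :
    ∃ π' : Measure (Geo X), IsProbabilityMeasure π' ∧ π' ≪ π ∧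
      π'.map (eval t) = ProbabilityTheory.cond m G := by
  set ρ := (π.map (eval t)).rnDeriv m
  have hρ : Measurable ρ := Measure.measurable_rnDeriv _ _
  let h : X → ℝ≥0∞ := G.indicator fun x => (m G)⁻¹ * (ρ x)⁻¹
  have hh : Measurable h := (hρ.inv.const_mul _).indicator hG
  have e : (π.withDensity (fun γ => h (eval t γ))).map (eval t) = ProbabilityTheory.cond m G := by
    rw [map_withDensity_comp π t hh]
    conv_lhs => rw [← Measure.withDensity_rnDeriv_eq _ m hac]
    rw [← withDensity_mul _ hρ hh]
    have e2 : (π.map (eval t)).rnDeriv m * h = G.indicator fun _ => (m G)⁻¹ := by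
      ext x
      by_cases hx : x ∈ G
      · simp only [Pi.mul_apply, h, indicator_of_mem hx]
        rw [mul_left_comm, ENNReal.mul_inv_cancel (hG0 x hx) (hG1 x hx), mul_one]
      · simp [h, hx]
    rw [e2, withDensity_indicator hG, withDensity_const]
    rfl
  refine ⟨π.withDensity (fun γ => h (eval t γ)), ?_, withDensity_absolutelyContinuous _ _, e⟩
  have hpc : IsProbabilityMeasure (ProbabilityTheory.cond m G) :=
    ProbabilityTheory.cond_isProbabilityMeasure_of_finite h0 h1
  constructor
  have := hpc.measure_univ
  rw [← e, Measure.map_apply (measurable_geval t) MeasurableSet.univ] at this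
  exact this

lemma second_moment_of_bounded {μ : Measure X} [IsFiniteMeasure μ] {s : Set X}
    (hs : Bornology.IsBounded s) (hne : Nonempty X) (h : ∀ᵐ x ∂μ, x ∈ s) :
    HasFiniteSecondMoment μ := by
  obtain ⟨x0⟩ := hne
  obtain ⟨r, hr⟩ := hs.subset_closedBall x0
  refine ⟨x0, ?_⟩
  have : ∫⁻ x, ENNReal.ofReal (dist x x0 ^ 2) ∂μ ≤ ∫⁻ x, ENNReal.ofReal (r ^ 2) ∂μ := by
    apply lintegral_mono_ae
    filter_upwards [h] with x hx
    exact ENNReal.ofReal_le_ofReal (pow_le_pow_left₀ dist_nonneg (hr hx) 2)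
  refine ne_top_of_le_ne_top ?_ this
  rw [lintegral_const]
  exact ENNReal.mul_ne_top ENNReal.ofReal_ne_top (measure_ne_top _ _)

/-- Bundled hypotheses. -/
structure Ctx (K N : ℝ) (m : Measure X) : Prop where
  hN : 1 ≤ N
  bdd : ∀ s : Set X, Bornology.IsBounded s → m s ≠ ⊤
  cd : IsCDStar K N m
  gt : GoodTransport m

/-- Entropy with exponent `N+1`. -/
abbrev Ent (N : ℝ) (m μ : Measure X) : ℝ≥0∞ := Fp (1 - 1 / (N + 1)) m μ

lemma expo {N : ℝ} (hN : 1 ≤ N) : 0 < 1 / (N + 1) ∧ 0 < 1 - 1 / (N + 1) ∧ 1 - 1 / (N + 1) < 1 := by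
  have hq0 : 0 < 1 / (N + 1) := by positivity
  have hq1 : 1 / (N + 1) < 1 := by rw [div_lt_one] <;> linarith
  refine ⟨hq0, by linarith, by linarith⟩

section Main
variable [TopologicalSpace.SeparableSpace X] [ProperSpace X] [BorelSpace X]
variable {K N : ℝ} {m : Measure X} [SigmaFinite m]

lemma Ent_cond (hN : 1 ≤ N) {G : Set X} (hG : MeasurableSet G) (h0 : m G ≠ 0)
    (h1 : m G ≠ ⊤) : Ent N m (ProbabilityTheory.cond m G) = m G ^ (1 / (N + 1)) := by
  rw [Ent, Fp_cond (expo hN).2.1 (expo hN).2.2 hG h0 h1]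
  congr 1; ring

lemma Ent_le (hN : 1 ≤ N) {μ : Measure X} (hμ : μ univ ≤ 1) {S : Set X}
    (hS : MeasurableSet S) (h : μ Sᶜ = 0) : Ent N m μ ≤ m S ^ (1 / (N + 1)) := by
  have := Fp_le (m := m) (expo hN).2.1 (expo hN).2.2 hμ hS h
  have e : (1 : ℝ) - (1 - 1 / (N + 1)) = 1 / (N + 1) := by ring
  rwa [e] at this

lemma Ent_pos (hN : 1 ≤ N) {μ : Measure X} [IsProbabilityMeasure μ] (hμ : μ ≪ m) :
    Ent N m μ ≠ 0 := Fp_pos (expo hN).2.1 hμ (IsProbabilityMeasure.ne_zero μ)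

lemma map_prob {π : Measure (Geo X)} [IsProbabilityMeasure π] (t : unitInterval) :
    IsProbabilityMeasure (π.map (eval t)) :=
  Measure.isProbabilityMeasure_map (measurable_geval t).aemeasurable

lemma measurable_contact {φ : X → ℝ} (hφ : Continuous φ) {B Y : Set X}
    (hB : IsCompact B) (hY : IsCompact Y) : MeasurableSet (Contact φ B Y) :=
  (isCompact_contact hφ hB hY).measurableSet

lemma start_plan (hc : Ctx K N m) {φ : X → ℝ} (hφ : Continuous φ) {B Y : Set X}
    (hB : IsCompact B) (hY : IsCompact Y) {E : Set X} (hE : MeasurableSet E)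
    (hsub : E ⊆ eval 0 '' Contact φ B Y) (h0 : m E ≠ 0) :
    ∃ π : Measure (Geo X), IsProbabilityMeasure π ∧ (∀ᵐ γ ∂π, γ ∈ Contact φ B Y) ∧
      π.map (eval 0) = ProbabilityTheory.cond m E ∧ CDplan K N m π := by
  have hCm := measurable_contact hφ hB hY
  have hEB : E ⊆ B := by
    intro x hx
    obtain ⟨γ, hγ, rfl⟩ := hsub hx
    exact hγ.1
  have h1 : m E ≠ ⊤ := hc.bdd E (hB.isBounded.subset hEB)
  have hEne : E.Nonempty := nonempty_of_measure_ne_zero h0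
  have hCne : (Contact φ B Y).Nonempty := by
    obtain ⟨x, hx⟩ := hEne
    obtain ⟨γ, hγ, _⟩ := hsub hx
    exact ⟨γ, hγ⟩
  obtain ⟨s, hs, hs2⟩ := exists_selection (isCompact_contact hφ hB hY) hCne
  have hpc : IsProbabilityMeasure (ProbabilityTheory.cond m E) :=
    ProbabilityTheory.cond_isProbabilityMeasure_of_finite h0 h1
  have haeE : ∀ᵐ x ∂(ProbabilityTheory.cond m E), x ∈ E := ProbabilityTheory.ae_cond_mem hE
  set π0 := (ProbabilityTheory.cond m E).map s with hπ0
  have hp0 : IsProbabilityMeasure π0 := Measure.isProbabilityMeasure_map hs.aemeasurable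
  have hmap0 : π0.map (eval 0) = ProbabilityTheory.cond m E := by
    rw [hπ0, Measure.map_map (measurable_geval 0) hs]
    have : (eval 0 ∘ s) =ᵐ[ProbabilityTheory.cond m E] id := by
      filter_upwards [haeE] with x hx
      exact (hs2 x (hsub hx)).2
    rw [Measure.map_congr this, Measure.map_id]
  have hae0 : ∀ᵐ γ ∂π0, γ ∈ Contact φ B Y := by
    rw [hπ0]
    apply (ae_map_iff hs.aemeasurable hCm).2
    filter_upwards [haeE] with x hx
    exact (hs2 x (hsub hx)).1
  have hpot : ∀ γ ∈ Contact φ B Y, eval 0 γ ∈ B ∧ eval 1 γ ∈ Y ∧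
      φ (eval 0 γ) + Psi φ B ((1 : unitInterval) : ℝ) (eval 1 γ) =
        dist (eval 0 γ) (eval 1 γ) ^ 2 := by
    intro γ hγ
    refine ⟨hγ.1, hγ.2.1, ?_⟩
    rw [Psi_contact hφ hB 1 (by simp) hγ]
    simp
  have hp1 : IsProbabilityMeasure (π0.map (eval 1)) := map_prob 1
  have hb : ∃ s : Set X, Bornology.IsBounded s ∧ (π0.map (eval 0)) sᶜ = 0 ∧
      (π0.map (eval 1)) sᶜ = 0 := by
    refine ⟨B ∪ Y, (hB.union hY).isBounded, ?_, ?_⟩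
    · rw [← mem_ae_iff]
      apply (ae_map_iff (measurable_geval 0).aemeasurable (hB.union hY).measurableSet).2
      filter_upwards [hae0] with γ hγ using Or.inl hγ.1
    · rw [← mem_ae_iff]
      apply (ae_map_iff (measurable_geval 1).aemeasurable (hB.union hY).measurableSet).2
      filter_upwards [hae0] with γ hγ using Or.inr hγ.2.1
  obtain ⟨π, hπ, hcdp⟩ := cd_exists hc.cd (map_prob 0) hp1 hb
  have hle : ∀ x ∈ B, ∀ y ∈ Y, φ x + Psi φ B ((1 : unitInterval) : ℝ) y ≤ dist x y ^ 2 := by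
    intro x hx y hy
    have := Psi_le hφ hB ((1 : unitInterval) : ℝ) y hx
    simp only [Set.Icc.coe_one, div_one] at this ⊢
    linarith
  have hres := pot_of_opt hB hY hφ (continuous_Psi hφ hB _) hle hp0
    (by filter_upwards [hae0] with γ hγ using hpot γ hγ) hπ
  refine ⟨π, hπ.1, ?_, hπ.2.1.trans hmap0, hcdp⟩
  filter_upwards [hres] with γ hγ
  refine ⟨hγ.1, hγ.2.1, fun x hx => ?_⟩
  have := hle x hx _ hγ.2.1
  linarith [hγ.2.2]

lemma map_restr (π : Measure (Geo X)) (a b l : unitInterval) :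
    (π.map (restr a b)).map (eval l) = π.map (eval (aff a b l)) := by
  rw [Measure.map_map (measurable_geval l) (continuous_restr a b).measurable]
  rfl

lemma scd (hc : Ctx K N m) {φ : X → ℝ} (hφ : Continuous φ) {B Y : Set X}
    (hB : IsCompact B) (hY : IsCompact Y) {π : Measure (Geo X)} [IsProbabilityMeasure π]
    (hπ : ∀ᵐ γ ∂π, γ ∈ Contact φ B Y) {a b : unitInterval} (hab : (a : ℝ) < b)
    (ha : π.map (eval a) ≪ m) (hb : π.map (eval b) ≪ m) :
    CDplan K N m (π.map (restr a b)) := by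
  obtain ⟨B', Y', u, v, hB', hY', hu, hv, hle, hcon⟩ := exists_pot hφ hB hY a b hab
  have hrm := (continuous_restr (X := X) a b).measurable
  have hp : IsProbabilityMeasure (π.map (restr a b)) :=
    Measure.isProbabilityMeasure_map hrm.aemeasurable
  have hae : ∀ᵐ γ ∂(π.map (restr a b)), eval 0 γ ∈ B' ∧ eval 1 γ ∈ Y' ∧
      u (eval 0 γ) + v (eval 1 γ) = dist (eval 0 γ) (eval 1 γ) ^ 2 := by
    have h0 := continuous_geval (X := X) 0
    have h1 := continuous_geval (X := X) 1
    apply (ae_map_iff hrm.aemeasurable ?_).2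
    · filter_upwards [hπ] with γ hγ
      have := hcon γ hγ
      simpa only [eval_restr, aff_zero, aff_one] using this
    · refine MeasurableSet.inter (measurable_geval 0 hB'.measurableSet)
        (MeasurableSet.inter (measurable_geval 1 hY'.measurableSet) ?_)
      exact (isClosed_eq (by fun_prop) (by fun_prop)).measurableSet
  have hopt := opt_of_pot hB' hY' hu hv hle hp hae
  have hne : Nonempty X := by
    obtain ⟨γ, _⟩ := (hae.and hae).exists
    exact ⟨eval 0 γ⟩
  have hP0 : IsProbabilityMeasure ((π.map (restr a b)).map (eval 0)) := map_prob 0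
  have hP1 : IsProbabilityMeasure ((π.map (restr a b)).map (eval 1)) := map_prob 1
  have m0 : ∀ᵐ x ∂((π.map (restr a b)).map (eval 0)), x ∈ B' := by
    apply (ae_map_iff (measurable_geval 0).aemeasurable hB'.measurableSet).2
    filter_upwards [hae] with γ hγ using hγ.1
  have m1 : ∀ᵐ x ∂((π.map (restr a b)).map (eval 1)), x ∈ Y' := by
    apply (ae_map_iff (measurable_geval 1).aemeasurable hY'.measurableSet).2
    filter_upwards [hae] with γ hγ using hγ.2.1
  obtain ⟨π', hπ', hcdp⟩ := cd_exists hc.cd hP0 hP1 ⟨B' ∪ Y', (hB'.union hY').isBounded, by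
    rw [← mem_ae_iff]; filter_upwards [m0] with x hx using Or.inl hx, by
    rw [← mem_ae_iff]; filter_upwards [m1] with x hx using Or.inr hx⟩
  have hu := (hc.gt _ _ hP0 hP1 (second_moment_of_bounded hB'.isBounded hne m0)
    (second_moment_of_bounded hY'.isBounded hne m1)
    (by rw [map_restr, aff_zero]; exact ha) (by rw [map_restr, aff_one]; exact hb)).1.unique hopt hπ'
  rw [hu]
  exact hcdp

lemma restr_dist_le {D : ℝ} {φ : X → ℝ} (hφ : Continuous φ) {B Y : Set X}
    (hB : IsCompact B) (hY : IsCompact Y) (hD : ∀ x ∈ B, ∀ y ∈ Y, dist x y ≤ D)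
    {π : Measure (Geo X)} (hπ : ∀ᵐ γ ∂π, γ ∈ Contact φ B Y) (a b : unitInterval) :
    ∀ᵐ γ ∂(π.map (restr a b)), dist (eval 0 γ) (eval 1 γ) ≤ D := by
  have h0 := continuous_geval (X := X) 0
  have h1 := continuous_geval (X := X) 1
  apply (ae_map_iff (continuous_restr (X := X) a b).measurable.aemeasurable
    (isClosed_le (by fun_prop) (by fun_prop)).measurableSet).2
  filter_upwards [hπ] with γ hγ
  rw [eval_restr, eval_restr, aff_zero, aff_one, eval_dist]
  have h2 : |(a : ℝ) - b| ≤ 1 := by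
    rw [abs_le]
    constructor <;> linarith [a.2.1, a.2.2, b.2.1, b.2.2]
  have h3 := hD _ hγ.1 _ hγ.2.1
  have h4 : (0 : ℝ) ≤ dist (eval 0 γ) (eval 1 γ) := dist_nonneg
  nlinarith

lemma scd_left (hc : Ctx K N m) {φ : X → ℝ} (hφ : Continuous φ) {B Y : Set X}
    (hB : IsCompact B) (hY : IsCompact Y) {D : ℝ} (hD : ∀ x ∈ B, ∀ y ∈ Y, dist x y ≤ D)
    {π : Measure (Geo X)} [IsProbabilityMeasure π]
    (hπ : ∀ᵐ γ ∂π, γ ∈ Contact φ B Y) {a b : unitInterval} (hab : (a : ℝ) < b)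
    (ha : π.map (eval a) ≪ m) (hb : π.map (eval b) ≪ m) (l : unitInterval) {c : ℝ≥0∞}
    (hcs : ∀ θ, 0 ≤ θ → θ ≤ D → c ≤ sigmaCoeff K (N + 1) (1 - (l : ℝ)) θ) :
    c * Ent N m (π.map (eval a)) ≤ Ent N m (π.map (eval (aff a b l))) := by
  have h := scd hc hφ hB hY hπ hab ha hb
  have hp : IsProbabilityMeasure (π.map (restr a b)) :=
    Measure.isProbabilityMeasure_map (continuous_restr (X := X) a b).measurable.aemeasurable
  have := cd_ineq_left hc.hN h l (c := c) (by
    filter_upwards [restr_dist_le hφ hB hY hD hπ a b] with γ hγ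
    exact hcs _ dist_nonneg hγ) (by rw [map_restr, aff_zero]; exact ha)
  rwa [map_restr, map_restr, aff_zero] at this

lemma scd_right (hc : Ctx K N m) {φ : X → ℝ} (hφ : Continuous φ) {B Y : Set X}
    (hB : IsCompact B) (hY : IsCompact Y) {D : ℝ} (hD : ∀ x ∈ B, ∀ y ∈ Y, dist x y ≤ D)
    {π : Measure (Geo X)} [IsProbabilityMeasure π]
    (hπ : ∀ᵐ γ ∂π, γ ∈ Contact φ B Y) {a b : unitInterval} (hab : (a : ℝ) < b)
    (ha : π.map (eval a) ≪ m) (hb : π.map (eval b) ≪ m) (l : unitInterval) {c : ℝ≥0∞}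
    (hcs : ∀ θ, 0 ≤ θ → θ ≤ D → c ≤ sigmaCoeff K (N + 1) (l : ℝ) θ) :
    c * Ent N m (π.map (eval b)) ≤ Ent N m (π.map (eval (aff a b l))) := by
  have h := scd hc hφ hB hY hπ hab ha hb
  have hp : IsProbabilityMeasure (π.map (restr a b)) :=
    Measure.isProbabilityMeasure_map (continuous_restr (X := X) a b).measurable.aemeasurable
  have := cd_ineq_right hc.hN h l (c := c) (by
    filter_upwards [restr_dist_le hφ hB hY hD hπ a b] with γ hγ
    exact hcs _ dist_nonneg hγ) (by rw [map_restr, aff_one]; exact hb)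
  rwa [map_restr, map_restr, aff_one] at this

lemma map_ac {π π' : Measure (Geo X)} (h : π' ≪ π) {t : unitInterval} (ht : π.map (eval t) ≪ m) :
    π'.map (eval t) ≪ m := (h.map (measurable_geval t)).trans ht

lemma map_cond (π : Measure (Geo X)) (t : unitInterval) {S : Set X} (hS : MeasurableSet S) :
    (ProbabilityTheory.cond π (eval t ⁻¹' S)).map (eval t) =
      ProbabilityTheory.cond (π.map (eval t)) S := by
  unfold ProbabilityTheory.cond
  rw [Measure.map_smul, Measure.restrict_map (measurable_geval t) hS,
    Measure.map_apply (measurable_geval t) hS]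

lemma scd_ac (hc : Ctx K N m) {φ : X → ℝ} (hφ : Continuous φ) {B Y : Set X}
    (hB : IsCompact B) (hY : IsCompact Y)
    {π : Measure (Geo X)} [IsProbabilityMeasure π]
    (hπ : ∀ᵐ γ ∂π, γ ∈ Contact φ B Y) {a b : unitInterval} (hab : (a : ℝ) < b)
    (ha : π.map (eval a) ≪ m) (hb : π.map (eval b) ≪ m) (l : unitInterval) (hl : (l : ℝ) < 1) :
    π.map (eval (aff a b l)) ≪ m := by
  refine Measure.AbsolutelyContinuous.mk fun S hS hS0 => ?_
  by_contra hne
  set s := aff a b l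
  have hme := measurable_geval (X := X) s
  have hne' : π (eval s ⁻¹' S) ≠ 0 := by rwa [Measure.map_apply hme hS] at hne
  obtain ⟨D, hD0, hD⟩ := exists_dist_bound hB hY
  have hprob : IsProbabilityMeasure (ProbabilityTheory.cond π (eval s ⁻¹' S)) :=
    ProbabilityTheory.cond_isProbabilityMeasure hne'
  have hac : ProbabilityTheory.cond π (eval s ⁻¹' S) ≪ π :=
    ProbabilityTheory.cond_absolutelyContinuous
  obtain ⟨c, hc0, hct, hcs⟩ := sigma_pos K (N := N + 1) (by linarith [hc.hN]) (t := 1 - (l : ℝ))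
    (by linarith) (by linarith [l.2.1]) D
  have h := scd_left hc hφ hB hY hD (hac.ae_le hπ) hab (map_ac hac ha) (map_ac hac hb) l hcs
  have hpa : IsProbabilityMeasure ((ProbabilityTheory.cond π (eval s ⁻¹' S)).map (eval a)) :=
    map_prob a
  have hps : IsProbabilityMeasure ((ProbabilityTheory.cond π (eval s ⁻¹' S)).map (eval s)) :=
    map_prob s
  have h2 := Ent_pos hc.hN (map_ac hac ha)
  have h3 : Ent N m ((ProbabilityTheory.cond π (eval s ⁻¹' S)).map (eval s)) ≤
      m S ^ (1 / (N + 1)) := by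
    apply Ent_le hc.hN hps.measure_univ.le hS
    rw [Measure.map_apply hme hS.compl]
    have := ProbabilityTheory.ae_cond_mem (μ := π) (hme hS)
    exact this
  rw [hS0, ENNReal.zero_rpow_of_pos (expo hc.hN).1] at h3
  have := h.trans h3
  rw [nonpos_iff_eq_zero, mul_eq_zero] at this
  tauto

lemma good_set_null {μ : Measure X} [IsFiniteMeasure μ] (h : μ ≪ m) :
    μ {x | μ.rnDeriv m x ≠ 0 ∧ μ.rnDeriv m x ≠ ⊤}ᶜ = 0 := by
  have hm := Measure.measurable_rnDeriv μ m
  have h1 : ∀ᵐ x ∂μ, μ.rnDeriv m x ≠ ⊤ := h.ae_le (Measure.rnDeriv_ne_top μ m)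
  have h2 : ∀ᵐ x ∂μ, μ.rnDeriv m x ≠ 0 := by
    filter_upwards [Measure.rnDeriv_pos h] with x hx using hx.ne'
  filter_upwards [h1, h2] with x hx hy using ⟨hy, hx⟩

lemma lemmaP (hc : Ctx K N m) {φ : X → ℝ} (hφ : Continuous φ) {B Y : Set X}
    (hB : IsCompact B) (hY : IsCompact Y) {E : Set X} (hE : MeasurableSet E)
    (hsub : E ⊆ eval 0 '' Contact φ B Y) (h0 : m E ≠ 0) {b : unitInterval} (hb : (b : ℝ) < 1) :
    ∃ E' ⊆ E, MeasurableSet E' ∧ m E' ≠ 0 ∧ ∃ π : Measure (Geo X), IsProbabilityMeasure π ∧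
      (∀ᵐ γ ∂π, γ ∈ Contact φ B Y) ∧ π.map (eval 0) = ProbabilityTheory.cond m E' ∧
      π.map (eval b) ≪ m := by
  have hEB : E ⊆ B := by
    intro x hx
    obtain ⟨γ, hγ, rfl⟩ := hsub hx
    exact hγ.1
  have h1 : m E ≠ ⊤ := hc.bdd E (hB.isBounded.subset hEB)
  obtain ⟨π, hp, hπ, hmap, hcdp⟩ := start_plan hc hφ hB hY hE hsub h0
  have hac0 : π.map (eval 0) ≪ m := by
    rw [hmap]; exact ProbabilityTheory.cond_absolutelyContinuous
  obtain ⟨D, hD0, hD⟩ := exists_dist_bound hB hY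
  obtain ⟨c, hc0, hct, hcs⟩ := sigma_pos K (N := N + 1) (by linarith [hc.hN]) (t := 1 - (b : ℝ))
    (by linarith) (by linarith [b.2.1]) D
  have hEnt := cd_ineq_left hc.hN hcdp b (c := c) (by
    filter_upwards [hπ] with γ hγ using hcs _ dist_nonneg (hD _ hγ.1 _ hγ.2.1)) hac0
  have hPb : IsProbabilityMeasure (π.map (eval b)) := map_prob b
  have hP0 : IsProbabilityMeasure (π.map (eval 0)) := map_prob 0
  obtain ⟨S, hS, hS1, hS2⟩ := Measure.mutuallySingular_singularPart (π.map (eval b)) m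
  have hmb := measurable_geval (X := X) b
  set π1 := π.restrict (eval b ⁻¹' S) with hπ1
  have hπ1π : π1 ≪ π := Measure.restrict_le_self.absolutelyContinuous
  have hacb : π1.map (eval b) ≪ m := by
    rw [hπ1, ← Measure.restrict_map hmb hS]
    refine Measure.AbsolutelyContinuous.mk fun A hA hA0 => ?_
    rw [Measure.restrict_apply hA]
    have e := Measure.haveLebesgueDecomposition_add (π.map (eval b)) m
    rw [e, Measure.add_apply]
    have z1 : (π.map (eval b)).singularPart m (A ∩ S) = 0 :=
      measure_mono_null inter_subset_right hS1
    have z2 : m.withDensity ((π.map (eval b)).rnDeriv m) (A ∩ S) = 0 :=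
      withDensity_absolutelyContinuous _ _ (measure_mono_null inter_subset_left hA0)
    rw [z1, z2, add_zero]
  have hne : π1 univ ≠ 0 := by
    intro hz
    have : Ent N m (π.map (eval b)) ≤ m Sᶜ ^ (1 / (N + 1)) := by
      apply Ent_le hc.hN hPb.measure_univ.le hS.compl
      rw [compl_compl, Measure.map_apply hmb hS]
      rwa [hπ1, Measure.restrict_apply_univ] at hz
    rw [hS2, ENNReal.zero_rpow_of_pos (expo hc.hN).1] at this
    have h3 := hEnt.trans this
    rw [nonpos_iff_eq_zero, mul_eq_zero] at h3
    have := Ent_pos hc.hN hac0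
    tauto
  have hac1 : π1.map (eval 0) ≪ m := map_ac hπ1π hac0
  set ρ := (π1.map (eval 0)).rnDeriv m with hρ
  have hρm : Measurable ρ := Measure.measurable_rnDeriv _ _
  have hgm : MeasurableSet {x | ρ x ≠ 0 ∧ ρ x ≠ ⊤} :=
    MeasurableSet.inter (hρm (measurableSet_singleton 0).compl)
      (hρm (measurableSet_singleton ⊤).compl)
  have hE'm : MeasurableSet (E ∩ {x | ρ x ≠ 0 ∧ ρ x ≠ ⊤}) := hE.inter hgm
  have hE'0 : m (E ∩ {x | ρ x ≠ 0 ∧ ρ x ≠ ⊤}) ≠ 0 := by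
    intro hz
    have z1 := hac1 hz
    have z2 := good_set_null hac1
    have z3 : π1.map (eval 0) Eᶜ = 0 := by
      have : π.map (eval 0) Eᶜ = 0 := by
        rw [hmap]
        exact ProbabilityTheory.ae_cond_mem hE
      exact (hπ1π.map (measurable_geval 0)) this
    apply hne
    have : π1.map (eval 0) univ = 0 := by
      refine measure_mono_null ?_ (measure_union_null (measure_union_null z1 z2) z3)
      intro x _
      by_cases hx : x ∈ E
      · by_cases hx2 : x ∈ {x | ρ x ≠ 0 ∧ ρ x ≠ ⊤}
        · exact Or.inl (Or.inl ⟨hx, hx2⟩)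
        · exact Or.inl (Or.inr hx2)
      · exact Or.inr hx
    rwa [Measure.map_apply (measurable_geval 0) MeasurableSet.univ] at this
  obtain ⟨π', hp', hac', hmap'⟩ := reweight 0 hac1 hE'm hE'0
    (ne_top_of_le_ne_top h1 (measure_mono inter_subset_left)) (fun x hx => hx.2.1)
    (fun x hx => hx.2.2)
  exact ⟨_, inter_subset_left, hE'm, hE'0, π', hp', (hac'.trans hπ1π).ae_le hπ, hmap',
    map_ac hac' hacb⟩

end Main

lemma exists_aff {a b s : unitInterval} (h1 : (a : ℝ) ≤ s) (h2 : (s : ℝ) ≤ b) (hab : (a : ℝ) < b) :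
    ∃ l : unitInterval, aff a b l = s ∧ (l : ℝ) = (s - a) / (b - a) := by
  have hba : 0 < (b : ℝ) - a := sub_pos.2 hab
  refine ⟨⟨(s - a) / (b - a), div_nonneg (by linarith) hba.le, ?_⟩, ?_, rfl⟩
  · rw [div_le_one hba]; linarith
  · apply Subtype.ext
    simp only [aff]
    field_simp
    ring

lemma exists_grid {Q : ℝ → Prop} {t0 r ε : ℝ} (h : t0 < r) (h0 : ¬ Q t0) (h1 : Q r) (hε : 0 < ε) :
    ∃ s s', t0 ≤ s ∧ s < s' ∧ s' ≤ r ∧ s' - s ≤ ε ∧ ¬ Q s ∧ Q s' := by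
  obtain ⟨n, hn⟩ := exists_nat_gt ((r - t0) / ε)
  have hn0 : (0 : ℝ) < n := lt_of_le_of_lt (div_nonneg (by linarith) hε.le) hn
  have hex : ∃ i : ℕ, Q (t0 + (r - t0) * i / n) := ⟨n, by
    have : t0 + (r - t0) * n / n = r := by field_simp; ring
    rwa [this]⟩
  classical
  have hf := Nat.find_spec hex
  have hle : Nat.find hex ≤ n := Nat.find_min' hex (by
    have : t0 + (r - t0) * n / n = r := by field_simp; ring
    rwa [this])
  have hmin := fun i => Nat.find_min hex (m := i)
  obtain ⟨i, hi⟩ : ∃ i, Nat.find hex = i + 1 := by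
    apply Nat.exists_eq_succ_of_ne_zero
    intro hz
    rw [hz] at hf
    simp at hf
    exact h0 hf
  rw [hi] at hf hle
  have hd : 0 < r - t0 := by linarith
  have hin : ((i + 1 : ℕ) : ℝ) ≤ n := by exact_mod_cast hle
  refine ⟨_, _, ?_, ?_, ?_, ?_, hmin i (by omega), hf⟩
  · have : 0 ≤ (r - t0) * i / n := by positivity
    linarith
  · push_cast
    gcongr
    linarith
  · have : (r - t0) * ((i + 1 : ℕ) : ℝ) / n ≤ r - t0 := by
      rw [div_le_iff₀ hn0]
      exact mul_le_mul_of_nonneg_left hin hd.le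
    linarith
  · have e : t0 + (r - t0) * ((i + 1 : ℕ) : ℝ) / n - (t0 + (r - t0) * i / n) = (r - t0) / n := by
      push_cast; field_simp; ring
    rw [e, div_le_iff₀ hn0]
    rw [div_lt_iff₀ hε] at hn
    linarith

section Main2
variable [ProperSpace X] [BorelSpace X]
variable {K N : ℝ} {m : Measure X} [IsFiniteMeasureOnCompacts m]

lemma ac_mid (hc : Ctx K N m) {φ : X → ℝ} (hφ : Continuous φ) {B Y : Set X}
    (hB : IsCompact B) (hY : IsCompact Y)
    {π : Measure (Geo X)} [IsProbabilityMeasure π]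
    (hπ : ∀ᵐ γ ∂π, γ ∈ Contact φ B Y) {b : unitInterval} (hb0 : (0 : ℝ) < b)
    (ha : π.map (eval 0) ≪ m) (hb : π.map (eval b) ≪ m) (s : unitInterval) (hs : (s : ℝ) ≤ b) :
    π.map (eval s) ≪ m := by
  rcases hs.eq_or_lt with h | h
  · have : s = b := Subtype.ext h
    rwa [this]
  · obtain ⟨l, hl1, hl2⟩ := exists_aff (a := 0) (b := b) (s := s) s.2.1 hs hb0
    have := scd_ac hc hφ hB hY hπ (a := 0) (b := b) hb0 ha hb l (by
      rw [hl2]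
      simp only [Set.Icc.coe_zero, sub_zero]
      rwa [div_lt_one hb0])
    rwa [hl1] at this

/-- overlap for small times -/
lemma overlap (hc : Ctx K N m) {φ : X → ℝ} (hφ : Continuous φ) {B Y : Set X}
    (hB : IsCompact B) (hY : IsCompact Y)
    {P1 P2 : Measure (Geo X)} [IsProbabilityMeasure P1] [IsProbabilityMeasure P2]
    (h1 : ∀ᵐ γ ∂P1, γ ∈ Contact φ B Y) (h2 : ∀ᵐ γ ∂P2, γ ∈ Contact φ B Y)
    {E : Set X} (hE : IsCompact E) (hE0 : m E ≠ 0)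
    (hm1 : P1.map (eval 0) = ProbabilityTheory.cond m E)
    (hm2 : P2.map (eval 0) = ProbabilityTheory.cond m E)
    {b r : unitInterval} (hr : (0 : ℝ) < r) (hrb : (r : ℝ) < b)
    (hb1 : P1.map (eval b) ≪ m) (hb2 : P2.map (eval b) ≪ m) :
    ∃ t : unitInterval, (0 : ℝ) < t ∧ (t : ℝ) < r ∧
      ¬ (P1.map (eval t)).MutuallySingular (P2.map (eval t)) := by
  obtain ⟨D, hD0, hD⟩ := exists_dist_bound hB hY
  have hN := hc.hN
  have hq := (expo hN).1
  have hEt : m E ≠ ⊤ := hE.measure_ne_top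
  obtain ⟨l0, hl0, hsig⟩ := sigma_near K (N := N + 1) (by linarith)
    (c := (3 / 4 : ℝ) ^ (1 / (N + 1))) (Real.rpow_lt_one (by norm_num) (by norm_num) hq) D
  have hlim := tendsto_measure_cthickening_of_isCompact (μ := m) hE
  have hlt : m E < (3 / 4 : ℝ≥0∞) * m E + (3 / 4 : ℝ≥0∞) * m E := by
    rw [← add_mul]
    have : (3 / 4 : ℝ≥0∞) + 3 / 4 = 1 + 2⁻¹ := by
      rw [← ENNReal.toReal_eq_toReal_iff' (by finiteness) (by finiteness)]
      rw [ENNReal.toReal_add (by finiteness) (by finiteness),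
        ENNReal.toReal_add (by finiteness) (by finiteness)]
      simp
      norm_num
    rw [this, add_mul, one_mul]
    apply ENNReal.lt_add_right hEt
    simp [hE0]
  have hev := hlim.eventually (gt_mem_nhds hlt)
  rw [Metric.eventually_nhds_iff] at hev
  obtain ⟨δ, hδ, hev⟩ := hev
  have hb0 : (0 : ℝ) < b := hr.trans hrb
  set t0 : ℝ := min (r / 2) (min (l0 * b) (δ / 2 / D)) with ht0
  have ht0pos : 0 < t0 := by
    refine lt_min (by linarith) (lt_min (by positivity) (by positivity))
  have ht0r : t0 < r := lt_of_le_of_lt (min_le_left _ _) (by linarith)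
  have ht0l : t0 ≤ l0 * b := (min_le_right _ _).trans (min_le_left _ _)
  have ht0d : t0 * D ≤ δ / 2 := by
    have : t0 ≤ δ / 2 / D := (min_le_right _ _).trans (min_le_right _ _)
    rwa [le_div_iff₀ hD0] at this
  let t : unitInterval := ⟨t0, ht0pos.le, ht0r.le.trans r.2.2⟩
  refine ⟨t, ht0pos, ht0r, ?_⟩
  set V := cthickening (t0 * D) E with hV
  have hVm : MeasurableSet V := isClosed_cthickening.measurableSet
  have hVlt : m V < (3 / 4 : ℝ≥0∞) * m E + (3 / 4 : ℝ≥0∞) * m E := by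
    apply hev
    rw [dist_zero_right, Real.norm_of_nonneg (by positivity)]
    linarith
  have key : ∀ P : Measure (Geo X), IsProbabilityMeasure P → (∀ᵐ γ ∂P, γ ∈ Contact φ B Y) →
      P.map (eval 0) = ProbabilityTheory.cond m E → P.map (eval b) ≪ m →
      ∀ S : Set X, MeasurableSet S → P.map (eval t) Sᶜ = 0 → (3 / 4 : ℝ≥0∞) * m E ≤ m (S ∩ V) := by
    intro P hP hae hmap hPb S hS hS0
    have hac0 : P.map (eval 0) ≪ m := by
      rw [hmap]; exact ProbabilityTheory.cond_absolutelyContinuous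
    obtain ⟨l, hl1, hl2⟩ := exists_aff (a := 0) (b := b) (s := t) t.2.1
      (ht0r.le.trans hrb.le) hb0
    have hll : (l : ℝ) ≤ l0 := by
      rw [hl2]
      simp only [Set.Icc.coe_zero, sub_zero]
      rwa [div_le_iff₀ hb0]
    have h := scd_left hc hφ hB hY hD hae (a := 0) (b := b) hb0 hac0 hPb l
      (hsig (1 - l) (by linarith [l.2.2]) (by linarith [l.2.1]) (by linarith))
    rw [hl1, hmap, Ent_cond hN hE.measurableSet hE0 hEt] at h
    have hPt : IsProbabilityMeasure (P.map (eval t)) := map_prob t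
    have haeE : ∀ᵐ γ ∂P, eval 0 γ ∈ E := by
      apply (ae_map_iff (measurable_geval 0).aemeasurable hE.measurableSet).1
      rw [hmap]
      exact ProbabilityTheory.ae_cond_mem hE.measurableSet
    have hV0 : P.map (eval t) Vᶜ = 0 := by
      rw [← mem_ae_iff]
      apply (ae_map_iff (measurable_geval t).aemeasurable hVm).2
      filter_upwards [haeE, hae] with γ g1 g2
      apply mem_cthickening_of_dist_le _ _ _ _ g1
      rw [eval_dist]
      have : |(t : ℝ) - ((0 : unitInterval) : ℝ)| = t0 := by
        simp [t, abs_of_pos ht0pos]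
      rw [this]
      exact mul_le_mul_of_nonneg_left (hD _ g2.1 _ g2.2.1) ht0pos.le
    have h3 : Ent N m (P.map (eval t)) ≤ m (S ∩ V) ^ (1 / (N + 1)) := by
      apply Ent_le hN hPt.measure_univ.le (hS.inter hVm)
      rw [compl_inter]
      exact measure_union_null hS0 hV0
    have h4 := h.trans h3
    have e : ENNReal.ofReal ((3 / 4 : ℝ) ^ (1 / (N + 1))) = (3 / 4 : ℝ≥0∞) ^ (1 / (N + 1)) := by
      rw [← ENNReal.ofReal_rpow_of_pos (by norm_num)]
      congr 1
      rw [ENNReal.ofReal_div_of_pos (by norm_num)]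
      simp
    rw [e, ← ENNReal.mul_rpow_of_nonneg _ _ hq.le] at h4
    exact (ENNReal.rpow_le_rpow_iff hq).1 h4
  rintro ⟨S, hS, hs1, hs2⟩
  have k1 := key P1 inferInstance h1 hm1 hb1 Sᶜ hS.compl (by rwa [compl_compl])
  have k2 := key P2 inferInstance h2 hm2 hb2 S hS hs2
  have k3 : m (Sᶜ ∩ V) + m (S ∩ V) = m V := by
    rw [add_comm, inter_comm S, inter_comm Sᶜ]
    exact measure_inter_add_sdiff V hS
  have := add_le_add k1 k2
  rw [k3] at this
  exact absurd hVlt (not_lt.2 this)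

end Main2

section Main3
variable [ProperSpace X] [BorelSpace X]
variable {K N : ℝ} {m : Measure X} [IsFiniteMeasureOnCompacts m]

lemma u1_core (hc : Ctx K N m) {φ : X → ℝ} (hφ : Continuous φ) {B Y : Set X}
    (hB : IsCompact B) (hY : IsCompact Y)
    {P1 P2 : Measure (Geo X)} [IsProbabilityMeasure P1] [IsProbabilityMeasure P2]
    (h1 : ∀ᵐ γ ∂P1, γ ∈ Contact φ B Y) (h2 : ∀ᵐ γ ∂P2, γ ∈ Contact φ B Y)
    {E : Set X} (hE : IsCompact E) (hE0 : m E ≠ 0)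
    (hm1 : P1.map (eval 0) = ProbabilityTheory.cond m E)
    (hm2 : P2.map (eval 0) = ProbabilityTheory.cond m E)
    {b r : unitInterval} (hr : (0 : ℝ) < r) (hrb : (r : ℝ) < b)
    (hb1 : P1.map (eval b) ≪ m) (hb2 : P2.map (eval b) ≪ m)
    (hsing : (P1.map (eval r)).MutuallySingular (P2.map (eval r))) : False := by
  have hN := hc.hN
  have hq := (expo hN).1
  have hp0 := (expo hN).2.1
  obtain ⟨D, hD0, hD⟩ := exists_dist_bound hB hY
  obtain ⟨t0, ht0, ht0r, hns⟩ := overlap hc hφ hB hY h1 h2 hE hE0 hm1 hm2 hr hrb hb1 hb2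
  have hb0 : (0 : ℝ) < b := hr.trans hrb
  set q := 1 / (N + 1) with hqdef
  obtain ⟨l0, hl0, hsig⟩ := sigma_near K (N := N + 1) (by linarith)
    (c := (2 : ℝ) ^ (-q / 4)) (Real.rpow_lt_one_of_one_lt_of_neg (by norm_num) (by linarith)) D
  have hcc : ENNReal.ofReal ((2 : ℝ) ^ (-q / 4)) = (2 : ℝ≥0∞) ^ (-q / 4) := by
    rw [← ENNReal.ofReal_rpow_of_pos (by norm_num)]
    simp
  rw [hcc] at hsig
  let Q : ℝ → Prop := fun t => ∃ h : t ∈ unitInterval,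
    (P1.map (eval ⟨t, h⟩)).MutuallySingular (P2.map (eval ⟨t, h⟩))
  have hbr : 0 < (b : ℝ) - r := by linarith
  obtain ⟨s0, s1, hts, hss, hsr, hse, hQ0, hQ1⟩ := exists_grid (Q := Q) (t0 := t0) (r := r)
    (ε := l0 * min (t0 : ℝ) (b - r)) ht0r (fun ⟨_, h⟩ => hns h) ⟨r.2, hsing⟩
    (mul_pos hl0 (lt_min ht0 hbr))
  have hs0I : s0 ∈ unitInterval := ⟨by linarith, by linarith [r.2.2]⟩
  obtain ⟨hs1I, hsing1⟩ := hQ1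
  have hns0 : ¬ (P1.map (eval ⟨s0, hs0I⟩)).MutuallySingular (P2.map (eval ⟨s0, hs0I⟩)) :=
    fun h => hQ0 ⟨hs0I, h⟩
  set s : unitInterval := ⟨s0, hs0I⟩ with hs
  set s' : unitInterval := ⟨s1, hs1I⟩ with hs'
  have hsv : (s : ℝ) = s0 := rfl
  have hsv' : (s' : ℝ) = s1 := rfl
  have hac1 : P1.map (eval 0) ≪ m := by
    rw [hm1]; exact ProbabilityTheory.cond_absolutelyContinuous
  have hac2 : P2.map (eval 0) ≪ m := by
    rw [hm2]; exact ProbabilityTheory.cond_absolutelyContinuous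
  have as1 := ac_mid hc hφ hB hY h1 hb0 hac1 hb1 s (by linarith)
  have as2 := ac_mid hc hφ hB hY h2 hb0 hac2 hb2 s (by linarith)
  have as1' := ac_mid hc hφ hB hY h1 hb0 hac1 hb1 s' (by linarith)
  have as2' := ac_mid hc hφ hB hY h2 hb0 hac2 hb2 s' (by linarith)
  set ρ1 := (P1.map (eval s)).rnDeriv m with hρ1
  set ρ2 := (P2.map (eval s)).rnDeriv m with hρ2
  have hm1' : Measurable ρ1 := Measure.measurable_rnDeriv _ _
  have hm2' : Measurable ρ2 := Measure.measurable_rnDeriv _ _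
  set A1 := {x | ρ1 x ≠ 0 ∧ ρ1 x ≠ ⊤} with hA1
  set A2 := {x | ρ2 x ≠ 0 ∧ ρ2 x ≠ ⊤} with hA2
  have hA1m : MeasurableSet A1 := MeasurableSet.inter (hm1' (measurableSet_singleton 0).compl)
      (hm1' (measurableSet_singleton ⊤).compl)
  have hA2m : MeasurableSet A2 := MeasurableSet.inter (hm2' (measurableSet_singleton 0).compl)
      (hm2' (measurableSet_singleton ⊤).compl)
  have z1 : P1.map (eval s) A1ᶜ = 0 := good_set_null as1
  have z2 : P2.map (eval s) A2ᶜ = 0 := good_set_null as2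
  have hG0 : m (A1 ∩ A2) ≠ 0 := by
    intro hz
    apply hns0
    refine ⟨A1ᶜ, hA1m.compl, z1, ?_⟩
    rw [compl_compl]
    refine measure_mono_null ?_ (measure_union_null (as2 hz) z2)
    intro x hx
    by_cases hx2 : x ∈ A2
    · exact Or.inl ⟨hx, hx2⟩
    · exact Or.inr hx2
  obtain ⟨G, hGm, hGs, hG1, hGt⟩ := Measure.exists_subset_measure_lt_top (μ := m) (r := 0)
    (hA1m.inter hA2m) (pos_iff_ne_zero.2 hG0)
  obtain ⟨Q1, hQp1, hQac1, hQm1⟩ := reweight s as1 hGm hG1.ne' hGt.ne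
    (fun x hx => (hGs hx).1.1) (fun x hx => (hGs hx).1.2)
  obtain ⟨Q2, hQp2, hQac2, hQm2⟩ := reweight s as2 hGm hG1.ne' hGt.ne
    (fun x hx => (hGs hx).2.1) (fun x hx => (hGs hx).2.2)
  set M := m G ^ q with hM
  have hM0 : M ≠ 0 := by
    rw [hM, ne_eq, ENNReal.rpow_eq_zero_iff]
    have := hG1.ne'
    have := hGt.ne
    rintro (h | h)
    · exact hG1.ne' h.1
    · exact hGt.ne h.1
  have hMt : M ≠ ⊤ := ENNReal.rpow_ne_top_of_nonneg hq.le hGt.ne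
  -- forward step
  have hsb : (s : ℝ) < b := by linarith
  obtain ⟨l, hl1, hl2⟩ := exists_aff (a := s) (b := b) (s := s') (by linarith) (by linarith) hsb
  have hll : (l : ℝ) ≤ l0 := by
    rw [hl2, div_le_iff₀ (by linarith), hsv, hsv']
    calc s1 - s0 ≤ l0 * min (t0 : ℝ) (b - r) := hse
      _ ≤ l0 * (b - s0) := by
        gcongr
        exact (min_le_right _ _).trans (by linarith)
  have fwd : ∀ P P' : Measure (Geo X), IsProbabilityMeasure P' → P' ≪ P →
      (∀ᵐ γ ∂P, γ ∈ Contact φ B Y) → P.map (eval s) ≪ m → P.map (eval b) ≪ m →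
      P'.map (eval s) = ProbabilityTheory.cond m G →
      (2 : ℝ≥0∞) ^ (-q / 4) * M ≤ Ent N m (P'.map (eval s')) := by
    intro P P' hP' hPP hae has hab hmap
    have := scd_left hc hφ hB hY hD (hPP.ae_le hae) hsb (map_ac hPP has) (map_ac hPP hab) l
      (hsig (1 - l) (by linarith [l.2.2]) (by linarith [l.2.1]) (by linarith))
    rwa [hl1, hmap, Ent_cond hN hGm hG1.ne' hGt.ne] at this
  have f1 := fwd P1 Q1 hQp1 hQac1 h1 as1 hb1 hQm1
  have f2 := fwd P2 Q2 hQp2 hQac2 h2 as2 hb2 hQm2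
  -- the mixture
  set R : Measure (Geo X) := (2⁻¹ : ℝ≥0∞) • (Q1 + Q2) with hR
  have hRmap : ∀ t : unitInterval, R.map (eval t) =
      (2⁻¹ : ℝ≥0∞) • (Q1.map (eval t) + Q2.map (eval t)) := by
    intro t
    rw [hR, Measure.map_smul, Measure.map_add _ _ (measurable_geval t)]
  have hRp : IsProbabilityMeasure R := by
    constructor
    simp only [hR, Measure.smul_apply, Measure.add_apply, measure_univ, smul_eq_mul]
    rw [one_add_one_eq_two, ENNReal.inv_mul_cancel (by norm_num) (by norm_num)]
  have hRac : ∀ t : unitInterval, P1.map (eval t) ≪ m → P2.map (eval t) ≪ m →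
      R.map (eval t) ≪ m := by
    intro t g1 g2
    rw [hRmap]
    refine Measure.AbsolutelyContinuous.mk fun S hS hS0 => ?_
    have k1 := map_ac hQac1 g1 hS0
    have k2 := map_ac hQac2 g2 hS0
    simp [k1, k2]
  have hRs : R.map (eval s) = ProbabilityTheory.cond m G := by
    rw [hRmap, hQm1, hQm2]
    ext S hS
    simp only [Measure.smul_apply, Measure.add_apply, smul_eq_mul]
    rw [← two_mul, ← mul_assoc, ENNReal.inv_mul_cancel (by norm_num) (by norm_num), one_mul]
  have hRae : ∀ᵐ γ ∂(R), γ ∈ Contact φ B Y := by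
    have k1 : Q1 (Contact φ B Y)ᶜ = 0 := hQac1 h1
    have k2 : Q2 (Contact φ B Y)ᶜ = 0 := hQac2 h2
    have : R (Contact φ B Y)ᶜ = 0 := by
      simp [hR, k1, k2]
    exact this
  have hs'0 : (0 : ℝ) < s' := by linarith
  obtain ⟨l', hl1', hl2'⟩ := exists_aff (a := 0) (b := s') (s := s) s.2.1 (by linarith) hs'0
  simp only [Set.Icc.coe_zero, sub_zero] at hl2'
  have hll' : 1 - l0 ≤ (l' : ℝ) := by
    rw [hl2', le_div_iff₀ hs'0, hsv, hsv']
    have : s1 - s0 ≤ l0 * s1 := by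
      calc s1 - s0 ≤ l0 * min (t0 : ℝ) (b - r) := hse
        _ ≤ l0 * s1 := by
          gcongr
          exact (min_le_left _ _).trans (by linarith)
    linarith
  have bwd := scd_right hc hφ hB hY hD hRae (a := 0) (b := s') hs'0 (hRac 0 hac1 hac2)
    (hRac s' as1' as2') l' (hsig l' l'.2.1 l'.2.2 hll')
  rw [hl1', hRs, Ent_cond hN hGm hG1.ne' hGt.ne, hRmap] at bwd
  have hsingQ := hsing1.mono_ac (hQac1.map (measurable_geval s')) (hQac2.map (measurable_geval s'))
  obtain ⟨S, hS, hs1, hs2⟩ := hsingQ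
  have hpa : IsProbabilityMeasure (Q1.map (eval s')) := map_prob s'
  have hpb : IsProbabilityMeasure (Q2.map (eval s')) := map_prob s'
  have mix := Fp_mix (m := m) hp0 (μ1 := Q1.map (eval s')) (μ2 := Q2.map (eval s')) hS.compl
    (by rwa [compl_compl]) hs2
  have fin : (2 : ℝ≥0∞) ^ (-q / 4) * ((2⁻¹ : ℝ≥0∞) ^ (1 - q) *
      ((2 : ℝ≥0∞) ^ (-q / 4) * M + (2 : ℝ≥0∞) ^ (-q / 4) * M)) ≤ M := by
    refine le_trans ?_ bwd
    gcongr
    refine le_trans ?_ mix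
    gcongr
  have e : (2 : ℝ≥0∞) ^ (-q / 4) * ((2⁻¹ : ℝ≥0∞) ^ (1 - q) *
      ((2 : ℝ≥0∞) ^ (-q / 4) * M + (2 : ℝ≥0∞) ^ (-q / 4) * M)) = 2 ^ (q / 2) * M := by
    have e1 : (2 : ℝ≥0∞) ^ (q / 2) =
        2 ^ (-q / 4) * (2 ^ (-(1 - q)) * ((2 : ℝ≥0∞) ^ (1 : ℝ) * 2 ^ (-q / 4))) := by
      rw [← ENNReal.rpow_add _ _ (by norm_num) (by norm_num),
        ← ENNReal.rpow_add _ _ (by norm_num) (by norm_num),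
        ← ENNReal.rpow_add _ _ (by norm_num) (by norm_num)]
      congr 1; ring
    rw [e1, ENNReal.inv_rpow, ← ENNReal.rpow_neg, ENNReal.rpow_one]
    ring
  rw [e] at fin
  have h5 : (1 : ℝ≥0∞) < 2 ^ (q / 2) := ENNReal.one_lt_rpow (by norm_num) (by linarith)
  have h6 : 1 * M < 2 ^ (q / 2) * M := (ENNReal.mul_lt_mul_iff_left hM0 hMt).2 h5
  rw [one_mul] at h6
  exact absurd fin (not_le.2 h6)

lemma contact_mono {φ : X → ℝ} {B Y Y' : Set X} (h : Y ⊆ Y') :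
    Contact φ B Y ⊆ Contact φ B Y' := fun _ hγ => ⟨hγ.1, h hγ.2.1, hγ.2.2⟩

lemma u1 (hc : Ctx K N m) {φ : X → ℝ} (hφ : Continuous φ) {B F1 F2 : Set X}
    (hB : IsCompact B) (hF1 : IsCompact F1) (hF2 : IsCompact F2) (hdis : Disjoint F1 F2) :
    m (eval 0 '' Contact φ B F1 ∩ eval 0 '' Contact φ B F2) = 0 := by
  by_contra h0
  have hY := hF1.union hF2
  obtain ⟨D, hD0, hD⟩ := exists_dist_bound hB hY
  obtain ⟨δ, hδ, hthick⟩ := hdis.exists_thickenings hF1 hF2.isClosed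
  set x : ℝ := min (1 / 2) (δ / 2 / D) with hx
  have hx0 : 0 < x := lt_min (by norm_num) (by positivity)
  have hx1 : x ≤ 1 / 2 := min_le_left _ _
  have hxD : x * D ≤ δ / 2 := by
    have : x ≤ δ / 2 / D := min_le_right _ _
    rwa [le_div_iff₀ hD0] at this
  let r : unitInterval := ⟨1 - x, by linarith, by linarith⟩
  let b : unitInterval := ⟨1 - x / 2, by linarith, by linarith⟩
  have hrv : (r : ℝ) = 1 - x := rfl
  have hbv : (b : ℝ) = 1 - x / 2 := rfl
  have hE0m : MeasurableSet (eval 0 '' Contact φ B F1 ∩ eval 0 '' Contact φ B F2) :=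
    ((isCompact_contact hφ hB hF1).image (continuous_geval 0)).measurableSet.inter
      ((isCompact_contact hφ hB hF2).image (continuous_geval 0)).measurableSet
  obtain ⟨E1, hE1s, hE1m, hE10, π1, hp1, hae1, hmap1, hb1⟩ := lemmaP hc hφ hB hF1 hE0m
    inter_subset_left h0 (b := b) (by linarith)
  obtain ⟨E2, hE2s, hE2m, hE20, π2, hp2, hae2, hmap2, hb2⟩ := lemmaP hc hφ hB hF2 hE1m
    (hE1s.trans inter_subset_right) hE10 (b := b) (by linarith)
  have hE1B : E1 ⊆ B := by
    intro y hy
    obtain ⟨γ, hγ, rfl⟩ := (hE1s hy).1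
    exact hγ.1
  have hE1t : m E1 ≠ ⊤ := hc.bdd _ (hB.isBounded.subset hE1B)
  have hE2t : m E2 ≠ ⊤ := hc.bdd _ (hB.isBounded.subset (hE2s.trans hE1B))
  obtain ⟨E, hEs, hE, hE0⟩ := hE2m.exists_lt_isCompact_of_ne_top hE2t (pos_iff_ne_zero.2 hE20)
  have hEt : m E ≠ ⊤ := hE.measure_ne_top
  have cnd : ∀ (π : Measure (Geo X)) (E' : Set X), MeasurableSet E' → IsProbabilityMeasure π →
      m E' ≠ ⊤ → E ⊆ E' → π.map (eval 0) = ProbabilityTheory.cond m E' →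
      IsProbabilityMeasure (ProbabilityTheory.cond π (eval 0 ⁻¹' E)) ∧
      (ProbabilityTheory.cond π (eval 0 ⁻¹' E)).map (eval 0) = ProbabilityTheory.cond m E := by
    intro π E' hE' hp ht hsub hmap
    have e : (ProbabilityTheory.cond π (eval 0 ⁻¹' E)).map (eval 0) =
        ProbabilityTheory.cond m E := by
      rw [map_cond π 0 hE.measurableSet, hmap,
        ProbabilityTheory.cond_cond_eq_cond_inter' hE' hE.measurableSet ht,
        inter_eq_self_of_subset_right hsub]
    refine ⟨?_, e⟩
    have hpc : IsProbabilityMeasure (ProbabilityTheory.cond m E) :=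
      ProbabilityTheory.cond_isProbabilityMeasure_of_finite hE0.ne' hEt
    constructor
    have := hpc.measure_univ
    rwa [← e, Measure.map_apply (measurable_geval 0) MeasurableSet.univ, preimage_univ] at this
  obtain ⟨q1, n1⟩ := cnd π1 E1 hE1m hp1 hE1t (hEs.trans hE2s) hmap1
  obtain ⟨q2, n2⟩ := cnd π2 E2 hE2m hp2 hE2t hEs hmap2
  have ac1 : ProbabilityTheory.cond π1 (eval 0 ⁻¹' E) ≪ π1 :=
    ProbabilityTheory.cond_absolutelyContinuous
  have ac2 : ProbabilityTheory.cond π2 (eval 0 ⁻¹' E) ≪ π2 :=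
    ProbabilityTheory.cond_absolutelyContinuous
  have near : ∀ F : Set X, F ⊆ F1 ∪ F2 → ∀ γ ∈ Contact φ B F, eval r γ ∈ thickening δ F := by
    intro F hF γ hγ
    rw [mem_thickening_iff]
    refine ⟨eval 1 γ, hγ.2.1, ?_⟩
    rw [eval_dist]
    have : |(r : ℝ) - ((1 : unitInterval) : ℝ)| = x := by
      rw [hrv, Set.Icc.coe_one]
      have : 1 - x - 1 = -x := by ring
      rw [this, abs_neg, abs_of_pos hx0]
    rw [this]
    have h3 := mul_le_mul_of_nonneg_left (hD _ hγ.1 _ (hF hγ.2.1)) hx0.le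
    linarith
  refine u1_core hc hφ hB hY (P1 := ProbabilityTheory.cond π1 (eval 0 ⁻¹' E))
    (P2 := ProbabilityTheory.cond π2 (eval 0 ⁻¹' E)) ?_ ?_ hE hE0.ne' n1 n2 (b := b) (r := r)
    (by linarith) (by linarith) (map_ac ac1 hb1) (map_ac ac2 hb2) ?_
  · filter_upwards [ac1.ae_le hae1] with γ hγ using contact_mono subset_union_left hγ
  · filter_upwards [ac2.ae_le hae2] with γ hγ using contact_mono subset_union_right hγ
  · refine ⟨thickening δ F2, isOpen_thickening.measurableSet, ?_, ?_⟩
    · rw [Measure.map_apply (measurable_geval r) isOpen_thickening.measurableSet]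
      have : ∀ᵐ γ ∂(ProbabilityTheory.cond π1 (eval 0 ⁻¹' E)), γ ∉ eval r ⁻¹' thickening δ F2 := by
        filter_upwards [ac1.ae_le hae1] with γ hγ hγ2
        exact disjoint_left.1 hthick (near F1 subset_union_left γ hγ) hγ2
      have h9 := ae_iff.1 this
      simp only [not_not] at h9
      exact h9
    · rw [Measure.map_apply (measurable_geval r) isOpen_thickening.measurableSet.compl]
      have : ∀ᵐ γ ∂(ProbabilityTheory.cond π2 (eval 0 ⁻¹' E)), γ ∈ eval r ⁻¹' thickening δ F2 := by
        filter_upwards [ac2.ae_le hae2] with γ hγ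
        exact near F2 subset_union_right γ hγ
      exact this

end Main3

section Main4
variable [ProperSpace X] [BorelSpace X]
variable {K N : ℝ} {m : Measure X} [IsFiniteMeasureOnCompacts m]

lemma u_all (hc : Ctx K N m) {φ : X → ℝ} (hφ : Continuous φ) {B Y : Set X}
    (hB : IsCompact B) :
    ∀ᵐ x ∂m, ∀ γ ∈ Contact φ B Y, ∀ γ' ∈ Contact φ B Y, eval 0 γ = x → eval 0 γ' = x → γ = γ' := by
  rcases isEmpty_or_nonempty X with hX | hX
  · exact Filter.Eventually.of_forall fun x => (hX.false x).elim
  have key : ∀ (p i j k : ℕ), ∀ᵐ x ∂m,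
      Disjoint (closedBall (TopologicalSpace.denseSeq X i) (1 / ((k : ℝ) + 1)))
        (closedBall (TopologicalSpace.denseSeq X j) (1 / ((k : ℝ) + 1))) →
      ¬ (x ∈ eval 0 '' Contact (fun x => (TopologicalSpace.denseSeq unitInterval p : ℝ) * φ x) B
          (closedBall (TopologicalSpace.denseSeq X i) (1 / ((k : ℝ) + 1))) ∧
        x ∈ eval 0 '' Contact (fun x => (TopologicalSpace.denseSeq unitInterval p : ℝ) * φ x) B
          (closedBall (TopologicalSpace.denseSeq X j) (1 / ((k : ℝ) + 1)))) := by
    intro p i j k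
    by_cases hd : Disjoint (closedBall (TopologicalSpace.denseSeq X i) (1 / ((k : ℝ) + 1)))
        (closedBall (TopologicalSpace.denseSeq X j) (1 / ((k : ℝ) + 1)))
    · have h := u1 hc (φ := fun x => (TopologicalSpace.denseSeq unitInterval p : ℝ) * φ x)
        (by fun_prop) hB (isCompact_closedBall _ _) (isCompact_closedBall _ _) hd
      have h2 := measure_eq_zero_iff_ae_notMem.1 h
      filter_upwards [h2] with x hx _ hh using hx hh
    · exact Filter.Eventually.of_forall fun x h => absurd h hd
  simp only [← ae_all_iff] at key
  filter_upwards [key] with x hx γ hγ γ' hγ' h0 h0'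
  by_contra hne
  have : ∃ p : ℕ, eval (TopologicalSpace.denseSeq unitInterval p) γ ≠
      eval (TopologicalSpace.denseSeq unitInterval p) γ' := by
    by_contra hcon
    push Not at hcon
    apply hne
    apply Subtype.ext
    apply DFunLike.coe_injective
    refine Continuous.ext_on (TopologicalSpace.denseRange_denseSeq unitInterval)
      γ.1.continuous γ'.1.continuous ?_
    rintro _ ⟨p, rfl⟩
    exact hcon p
  obtain ⟨p, hp⟩ := this
  set q := TopologicalSpace.denseSeq unitInterval p
  have hd := dist_pos.2 hp
  obtain ⟨k, hk⟩ := exists_nat_one_div_lt (show 0 < dist (eval q γ) (eval q γ') / 4 by linarith)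
  have hk0 : 0 < 1 / ((k : ℝ) + 1) := by positivity
  obtain ⟨i, hi⟩ := (TopologicalSpace.denseRange_denseSeq X).exists_dist_lt (eval q γ) hk0
  obtain ⟨j, hj⟩ := (TopologicalSpace.denseRange_denseSeq X).exists_dist_lt (eval q γ') hk0
  refine hx p i j k ?_ ⟨⟨restr 0 q γ, restr_contact hγ q ?_, ?_⟩,
    ⟨restr 0 q γ', restr_contact hγ' q ?_, ?_⟩⟩
  · apply closedBall_disjoint_closedBall
    have := dist_triangle4 (eval q γ) (TopologicalSpace.denseSeq X i)
      (TopologicalSpace.denseSeq X j) (eval q γ')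
    rw [dist_comm (TopologicalSpace.denseSeq X j) (eval q γ')] at this
    linarith
  · exact mem_closedBall.2 hi.le
  · rw [eval_restr, aff_zero, h0]
  · exact mem_closedBall.2 hj.le
  · rw [eval_restr, aff_zero, h0']

lemma bdd_bound (hc : Ctx K N m) {φ : X → ℝ} (hφ : Continuous φ) {B Y : Set X}
    (hB : IsCompact B) (hY : IsCompact Y) {π : Measure (Geo X)} [IsFiniteMeasure π]
    (hπ : ∀ᵐ γ ∂π, γ ∈ Contact φ B Y) {C : ℝ≥0∞} (hC : C ≠ ⊤) (h0 : π.map (eval 0) ≤ C • m)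
    (t : unitInterval) (ht : (t : ℝ) < 1) :
    ∃ C' : ℝ≥0∞, C' ≠ ⊤ ∧ π.map (eval t) ≤ C' • m := by
  have hN := hc.hN
  obtain ⟨D, hD0, hD⟩ := exists_dist_bound hB hY
  obtain ⟨c, hc0, hct, hcs⟩ := sigma_pos K (show 0 < N + 1 by linarith)
    (show 0 < 1 - (t : ℝ) by linarith) (by linarith [t.2.1]) D
  have hq := (expo hN).1
  have hfin : IsFiniteMeasure (π.map (eval t)) := by infer_instance
  set c' : ℝ≥0∞ := c⁻¹ ^ (N + 1) with hc'
  have hc't : c' ≠ ⊤ := ENNReal.rpow_ne_top_of_nonneg (by linarith) (ENNReal.inv_ne_top.2 hc0)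
  refine ⟨C * c', ENNReal.mul_ne_top hC hc't, ?_⟩
  have hcpt : ∀ F : Set X, IsCompact F → π.map (eval t) F ≤ C * c' * m F := by
    intro F hF
    set A : Set (Geo X) := Contact φ B Y ∩ eval t ⁻¹' F with hA
    have hAc : IsCompact A :=
      (isCompact_contact hφ hB hY).inter_right (hF.isClosed.preimage (continuous_geval t))
    set E : Set X := eval 0 '' A with hE
    have hEc : IsCompact E := hAc.image (continuous_geval 0)
    have h1 : π.map (eval t) F ≤ C * m E := by
      rw [Measure.map_apply (measurable_geval t) hF.measurableSet]
      have : π (eval t ⁻¹' F) ≤ π (eval 0 ⁻¹' E) := by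
        apply measure_mono_ae
        filter_upwards [hπ] with γ hγ hγF
        exact ⟨γ, ⟨hγ, hγF⟩, rfl⟩
      refine this.trans ?_
      rw [← Measure.map_apply (measurable_geval 0) hEc.measurableSet]
      exact h0 E
    suffices h2 : m E ≤ c' * m F by
      rw [mul_assoc]; exact h1.trans (mul_le_mul_right h2 _)
    by_cases hE0 : m E = 0
    · simp [hE0]
    obtain ⟨π', hp, hae, hmap, hcd⟩ := start_plan hc hφ hB hY hEc.measurableSet
      (image_mono inter_subset_left) hE0
    have hac : π'.map (eval 0) ≪ m := by
      rw [hmap]; exact ProbabilityTheory.cond_absolutelyContinuous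
    have hU := ae_of_ae_map (measurable_geval (X := X) 0).aemeasurable
      (hac.ae_le (u_all hc hφ hB (Y := Y)))
    have hEE : ∀ᵐ γ ∂π', eval 0 γ ∈ E := by
      apply ae_of_ae_map (measurable_geval (X := X) 0).aemeasurable
      rw [hmap]
      exact ProbabilityTheory.ae_cond_mem hEc.measurableSet
    have hF' : ∀ᵐ γ ∂π', γ ∈ eval t ⁻¹' F := by
      filter_upwards [hU, hEE, hae] with γ h1 h2 h3
      obtain ⟨γ', h4, h5⟩ := h2
      rw [h1 γ h3 γ' h4.1 rfl h5]
      exact h4.2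
    have hle := cd_ineq_left hN hcd t (c := c) (by
      filter_upwards [hae] with γ hγ
      exact hcs _ dist_nonneg (hD _ hγ.1 _ hγ.2.1)) hac
    rw [hmap] at hle
    have hEe := Ent_cond (m := m) hN hEc.measurableSet hE0 hEc.measure_ne_top
    have hpt : IsProbabilityMeasure (π'.map (eval t)) := map_prob t
    have hFe := Ent_le (m := m) hN (μ := π'.map (eval t)) prob_le_one hF.measurableSet (by
      rw [Measure.map_apply (measurable_geval t) hF.measurableSet.compl]
      exact hF')
    have h6 : c * m E ^ (1 / (N + 1)) ≤ m F ^ (1 / (N + 1)) := by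
      rw [← hEe]; exact hle.trans hFe
    have h7 : m E ^ (1 / (N + 1)) ≤ c⁻¹ * m F ^ (1 / (N + 1)) := by
      rw [← ENNReal.div_eq_inv_mul, ENNReal.le_div_iff_mul_le (Or.inl hc0) (Or.inl hct), mul_comm]
      exact h6
    have h8 := ENNReal.rpow_le_rpow h7 (show 0 ≤ N + 1 by linarith)
    rw [ENNReal.mul_rpow_of_nonneg _ _ (by linarith), ← ENNReal.rpow_mul, ← ENNReal.rpow_mul,
      one_div_mul_cancel (by linarith), ENNReal.rpow_one, ENNReal.rpow_one] at h8
    exact h8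
  refine Measure.le_iff.2 fun S hS => ?_
  rw [hS.measure_eq_iSup_isCompact]
  refine iSup₂_le fun F hFS => iSup_le fun hF => ?_
  refine (hcpt F hF).trans ?_
  rw [Measure.smul_apply, smul_eq_mul]
  exact mul_le_mul_right (measure_mono hFS) _

end Main4

section CM
open Filter Topology

lemma near_sq (p q : X) {η : ℝ} (hη : 0 < η) :
    ∀ᶠ ε in 𝓝[>] (0 : ℝ), ∀ x ∈ ball p ε, ∀ y ∈ ball q ε,
      dist p q ^ 2 - η ≤ dist x y ^ 2 ∧ dist x y ^ 2 ≤ dist p q ^ 2 + η := by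
  have hD : 0 ≤ dist p q := dist_nonneg
  have hpos : 0 < min 1 (η / (4 * (1 + dist p q))) := by positivity
  filter_upwards [Ioo_mem_nhdsGT hpos] with ε hε x hx y hy
  rw [mem_ball] at hx hy
  have h1 : ε < 1 := hε.2.trans_le (min_le_left _ _)
  have h2 : ε < η / (4 * (1 + dist p q)) := hε.2.trans_le (min_le_right _ _)
  rw [lt_div_iff₀ (by positivity)] at h2
  have h3 := dist_triangle4 x p q y
  have h4 := dist_triangle4 p x y q
  rw [dist_comm q y] at h3
  rw [dist_comm p x] at h4
  have h5 : 0 ≤ dist x y := dist_nonneg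
  have h0 := hε.1
  constructor <;> nlinarith

variable [ProperSpace X] [BorelSpace X]
variable {K N : ℝ} {m : Measure X}

lemma cyc_mono (hCD : IsCDStar K N m) {μ ν : Measure X} {π : Measure (Geo X)}
    (hπ : IsOptGeo μ ν π) (hfin : transportCost π ≠ ⊤) {ι : Type} [Fintype ι] [Nonempty ι]
    (g : ι → Geo X) (hg : ∀ i, g i ∈ π.support) (sg : Equiv.Perm ι) :
    ∑ i, dist (eval 0 (g i)) (eval 1 (g i)) ^ 2 ≤
      ∑ i, dist (eval 0 (g (sg i))) (eval 1 (g i)) ^ 2 := by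
  obtain ⟨hprob, hmap0, hmap1, hopt⟩ := hπ
  suffices H : ∀ η : ℝ, 0 < η → ∑ i, dist (eval 0 (g i)) (eval 1 (g i)) ^ 2 ≤
      ∑ i, dist (eval 0 (g (sg i))) (eval 1 (g i)) ^ 2 + 2 * Fintype.card ι * η by
    have hcard : 0 < (Fintype.card ι : ℝ) := by exact_mod_cast Fintype.card_pos
    refine le_of_forall_pos_le_add fun δ hδ => ?_
    have := H (δ / (2 * Fintype.card ι)) (by positivity)
    have e : 2 * Fintype.card ι * (δ / (2 * Fintype.card ι)) = δ := by field_simp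
    rwa [e] at this
  intro η hη
  have hev : ∀ᶠ ε in 𝓝[>] (0 : ℝ), (0 < ε) ∧ (∀ i, ∀ x ∈ ball (eval 0 (g i)) ε,
      ∀ y ∈ ball (eval 1 (g i)) ε,
      dist (eval 0 (g i)) (eval 1 (g i)) ^ 2 - η ≤ dist x y ^ 2) ∧
      ∀ i, ∀ x ∈ ball (eval 0 (g (sg i))) ε, ∀ y ∈ ball (eval 1 (g i)) ε,
      dist x y ^ 2 ≤ dist (eval 0 (g (sg i))) (eval 1 (g i)) ^ 2 + η := by
    refine (eventually_mem_nhdsWithin).and ((eventually_all.2 fun i => ?_).and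
      (eventually_all.2 fun i => ?_))
    · filter_upwards [near_sq (eval 0 (g i)) (eval 1 (g i)) hη] with ε h x hx y hy
      exact (h x hx y hy).1
    · filter_upwards [near_sq (eval 0 (g (sg i))) (eval 1 (g i)) hη] with ε h x hx y hy
      exact (h x hx y hy).2
  obtain ⟨ε, hε0, hlow, hup⟩ := hev.exists
  have m0 := measurable_geval (X := X) 0
  have m1 := measurable_geval (X := X) 1
  let U : ι → Set (Geo X) := fun i =>
    eval 0 ⁻¹' ball (eval 0 (g i)) ε ∩ eval 1 ⁻¹' ball (eval 1 (g i)) ε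
  have hUo : ∀ i, IsOpen (U i) := fun i =>
    (isOpen_ball.preimage (continuous_geval 0)).inter (isOpen_ball.preimage (continuous_geval 1))
  have hUpos : ∀ i, π (U i) ≠ 0 := fun i =>
    (((Measure.mem_support_iff_forall _).1 (hg i)) (U i) ((hUo i).mem_nhds
      ⟨mem_ball_self hε0, mem_ball_self hε0⟩)).ne'
  let P : ι → Measure (Geo X) := fun i => ProbabilityTheory.cond π (U i)
  have hP : ∀ i, IsProbabilityMeasure (P i) := fun i =>
    ProbabilityTheory.cond_isProbabilityMeasure_of_finite (hUpos i) (measure_ne_top _ _)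
  have hPU : ∀ i, ∀ᵐ γ ∂(P i), γ ∈ U i := fun i =>
    ProbabilityTheory.ae_cond_mem (hUo i).measurableSet
  have hQ : ∀ i, ∃ Q, IsOptGeo ((P (sg i)).map (eval 0)) ((P i).map (eval 1)) Q ∧
      CDplan K N m Q := by
    intro i
    refine cd_exists hCD (Measure.isProbabilityMeasure_map m0.aemeasurable)
      (Measure.isProbabilityMeasure_map m1.aemeasurable)
      ⟨ball (eval 0 (g (sg i))) ε ∪ ball (eval 1 (g i)) ε, isBounded_ball.union isBounded_ball,
        ?_, ?_⟩
    · rw [Measure.map_apply m0 (measurableSet_ball.union measurableSet_ball).compl]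
      have : ∀ᵐ γ ∂(P (sg i)), γ ∈ eval 0 ⁻¹' (ball (eval 0 (g (sg i))) ε ∪ ball (eval 1 (g i)) ε) := by
        filter_upwards [hPU (sg i)] with γ hγ using Or.inl hγ.1
      exact this
    · rw [Measure.map_apply m1 (measurableSet_ball.union measurableSet_ball).compl]
      have : ∀ᵐ γ ∂(P i), γ ∈ eval 1 ⁻¹' (ball (eval 0 (g (sg i))) ε ∪ ball (eval 1 (g i)) ε) := by
        filter_upwards [hPU i] with γ hγ using Or.inr hγ.2
      exact this
  choose Q hQ _ using hQ
  have hQp : ∀ i, IsProbabilityMeasure (Q i) := fun i => (hQ i).1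
  have hQ0 : ∀ i, (Q i).map (eval 0) = (P (sg i)).map (eval 0) := fun i => (hQ i).2.1
  have hQ1 : ∀ i, (Q i).map (eval 1) = (P i).map (eval 1) := fun i => (hQ i).2.2.1
  set L : ℝ≥0∞ := ∑ i, (π (U i))⁻¹ with hL
  have hLt : L ≠ ⊤ := by
    rw [hL]; exact ENNReal.sum_ne_top.2 fun i _ => ENNReal.inv_ne_top.2 (hUpos i)
  have hL0 : L ≠ 0 := by
    obtain ⟨i⟩ := ‹Nonempty ι›
    intro h
    have := Finset.sum_eq_zero_iff.1 h i (Finset.mem_univ i)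
    exact (ENNReal.inv_ne_zero.2 (measure_ne_top _ _)) this
  set S : Measure (Geo X) := L⁻¹ • ∑ i, P i with hS
  have hSle : S ≤ π := by
    refine Measure.le_iff.2 fun A hA => ?_
    rw [hS, Measure.smul_apply, smul_eq_mul, Measure.finsetSum_apply]
    have : ∑ i, P i A ≤ L * π A := by
      rw [hL, Finset.sum_mul]
      refine Finset.sum_le_sum fun i _ => ?_
      simp only [P, ProbabilityTheory.cond, Measure.smul_apply, smul_eq_mul]
      exact mul_le_mul_right (Measure.restrict_apply_le _ _) _
    refine (mul_le_mul_right this _).trans ?_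
    rw [← mul_assoc, ENNReal.inv_mul_cancel hL0 hLt, one_mul]
  have hSfin : IsFiniteMeasure S := ⟨(hSle univ).trans_lt (measure_lt_top _ _)⟩
  have hsub : π - S + S = π := Measure.sub_add_cancel_of_le hSle
  set R' : Measure (Geo X) := π - S with hR'
  set S' : Measure (Geo X) := L⁻¹ • ∑ i, Q i with hS'
  have hmS0 : S'.map (eval 0) = S.map (eval 0) := by
    rw [hS, hS', Measure.map_smul, Measure.map_smul, Measure.map_finset_sum (by fun_prop),
      Measure.map_finset_sum (by fun_prop)]
    congr 1
    simp_rw [hQ0]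
    exact Equiv.sum_comp sg fun i => (P i).map (eval 0)
  have hmS1 : S'.map (eval 1) = S.map (eval 1) := by
    rw [hS, hS', Measure.map_smul, Measure.map_smul, Measure.map_finset_sum (by fun_prop),
      Measure.map_finset_sum (by fun_prop)]
    congr 1
    simp_rw [hQ1]
  have k0 : (R' + S').map (eval 0) = μ := by
    rw [Measure.map_add _ _ m0, hmS0, ← Measure.map_add _ _ m0, hsub, hmap0]
  have k1 : (R' + S').map (eval 1) = ν := by
    rw [Measure.map_add _ _ m1, hmS1, ← Measure.map_add _ _ m1, hsub, hmap1]
  have kp : IsProbabilityMeasure (R' + S') := by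
    have hμ : IsProbabilityMeasure μ := hmap0 ▸ Measure.isProbabilityMeasure_map m0.aemeasurable
    constructor
    have := hμ.measure_univ
    rwa [← k0, Measure.map_apply m0 MeasurableSet.univ, preimage_univ] at this
  have hle := hopt _ kp k0 k1
  have hcR : transportCost R' ≠ ⊤ := by
    refine ne_top_of_le_ne_top hfin ?_
    exact lintegral_mono' Measure.sub_le le_rfl
  have e1 : transportCost π = transportCost R' + L⁻¹ * ∑ i, transportCost (P i) := by
    rw [← hsub]
    simp only [transportCost, lintegral_add_measure, hS, lintegral_smul_measure,
      lintegral_finsetSum_measure, smul_eq_mul]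
  have e2 : transportCost (R' + S') = transportCost R' + L⁻¹ * ∑ i, transportCost (Q i) := by
    simp only [transportCost, lintegral_add_measure, hS', lintegral_smul_measure,
      lintegral_finsetSum_measure, smul_eq_mul]
  rw [e1, e2, ENNReal.add_le_add_iff_left hcR,
    ENNReal.mul_le_mul_iff_right (ENNReal.inv_ne_zero.2 hLt) (ENNReal.inv_ne_top.2 hL0)] at hle
  have hPlow : ∀ i, ENNReal.ofReal (max (dist (eval 0 (g i)) (eval 1 (g i)) ^ 2 - η) 0) ≤
      transportCost (P i) := by
    intro i
    have : ∫⁻ γ, ENNReal.ofReal (max (dist (eval 0 (g i)) (eval 1 (g i)) ^ 2 - η) 0) ∂(P i) ≤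
        transportCost (P i) := by
      refine lintegral_mono_ae ?_
      filter_upwards [hPU i] with γ hγ
      exact ENNReal.ofReal_le_ofReal (max_le (hlow i _ hγ.1 _ hγ.2) (sq_nonneg _))
    simpa using this
  have hQup : ∀ i, transportCost (Q i) ≤
      ENNReal.ofReal (dist (eval 0 (g (sg i))) (eval 1 (g i)) ^ 2 + η) := by
    intro i
    have b0 : ∀ᵐ γ ∂(Q i), eval 0 γ ∈ ball (eval 0 (g (sg i))) ε := by
      refine ae_of_ae_map m0.aemeasurable ?_
      rw [hQ0]
      refine (ae_map_iff m0.aemeasurable measurableSet_ball).2 ?_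
      filter_upwards [hPU (sg i)] with γ hγ using hγ.1
    have b1 : ∀ᵐ γ ∂(Q i), eval 1 γ ∈ ball (eval 1 (g i)) ε := by
      refine ae_of_ae_map m1.aemeasurable ?_
      rw [hQ1]
      refine (ae_map_iff m1.aemeasurable measurableSet_ball).2 ?_
      filter_upwards [hPU i] with γ hγ using hγ.2
    have : transportCost (Q i) ≤
        ∫⁻ γ, ENNReal.ofReal (dist (eval 0 (g (sg i))) (eval 1 (g i)) ^ 2 + η) ∂(Q i) := by
      refine lintegral_mono_ae ?_
      filter_upwards [b0, b1] with γ h0 h1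
      exact ENNReal.ofReal_le_ofReal (hup i _ h0 _ h1)
    simpa using this
  have h9 := ((Finset.sum_le_sum fun i _ => hPlow i).trans hle).trans
    (Finset.sum_le_sum fun i _ => hQup i)
  rw [← ENNReal.ofReal_sum_of_nonneg (fun i _ => le_max_right _ _),
    ← ENNReal.ofReal_sum_of_nonneg (fun i _ => by positivity),
    ENNReal.ofReal_le_ofReal_iff (Finset.sum_nonneg fun i _ => by positivity)] at h9
  have h10 := (Finset.sum_le_sum (s := Finset.univ) fun i _ =>
    le_max_left (dist (eval 0 (g i)) (eval 1 (g i)) ^ 2 - η) 0).trans h9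
  rw [Finset.sum_sub_distrib, Finset.sum_add_distrib] at h10
  simp only [Finset.sum_const, Finset.card_univ, nsmul_eq_mul] at h10
  linarith

lemma cyc_chain (hCD : IsCDStar K N m) {μ ν : Measure X} {π : Measure (Geo X)}
    (hπ : IsOptGeo μ ν π) (hfin : transportCost π ≠ ⊤)
    (f : ℕ → Geo X) (hf : ∀ i, f i ∈ π.support) (n : ℕ) :
    0 ≤ ∑ i ∈ Finset.range n, (dist (eval 0 (f (i + 1))) (eval 1 (f i)) ^ 2 -
        dist (eval 0 (f i)) (eval 1 (f i)) ^ 2) +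
      (dist (eval 0 (f 0)) (eval 1 (f n)) ^ 2 - dist (eval 0 (f n)) (eval 1 (f n)) ^ 2) := by
  have h := cyc_mono hCD hπ hfin (ι := Fin (n + 1)) (fun i => f i) (fun i => hf i)
    (finRotate (n + 1))
  rw [Fin.sum_univ_castSucc, Fin.sum_univ_castSucc] at h
  simp only [finRotate_last, Fin.val_castSucc, Fin.val_last, Fin.val_zero] at h
  have e : ∀ i : Fin n, ((finRotate (n + 1) i.castSucc : Fin (n + 1)) : ℕ) = i + 1 := by
    intro i
    rw [coe_finRotate_of_ne_last (Fin.castSucc_lt_last i).ne]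
    rfl
  simp only [e] at h
  rw [Fin.sum_univ_eq_sum_range (fun i => dist (eval 0 (f i)) (eval 1 (f i)) ^ 2),
    Fin.sum_univ_eq_sum_range (fun i => dist (eval 0 (f (i + 1))) (eval 1 (f i)) ^ 2)] at h
  rw [Finset.sum_sub_distrib]
  linarith

end CM

section Pot
open Filter Topology

/-- Chain functional. -/
def chS (f : ℕ → Geo X) (n : ℕ) (x : X) : ℝ :=
  ∑ i ∈ Finset.range n, (dist (eval 0 (f (i + 1))) (eval 1 (f i)) ^ 2 -
        dist (eval 0 (f i)) (eval 1 (f i)) ^ 2) +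
      (dist x (eval 1 (f n)) ^ 2 - dist (eval 0 (f n)) (eval 1 (f n)) ^ 2)

lemma sq_lip {x x' y x0 : X} {M : ℝ} (hy : dist y x0 ≤ M) :
    dist x y ^ 2 ≤ dist x' y ^ 2 + dist x x' * (dist x x0 + dist x' x0 + 2 * M) := by
  have h1 := dist_triangle x x' y
  have h2 := dist_triangle x x0 y
  have h3 := dist_triangle x' x0 y
  rw [dist_comm x0 y] at h2 h3
  have h4 : 0 ≤ dist x x' := dist_nonneg
  have h5 : 0 ≤ dist x y := dist_nonneg
  have h6 : 0 ≤ dist x' y := dist_nonneg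
  nlinarith

lemma rock {G : Set (Geo X)} {x0 : X} {M : ℝ} (hM0 : 0 ≤ M)
    (hM : ∀ γ ∈ G, dist (eval 0 γ) x0 ≤ M ∧ dist (eval 1 γ) x0 ≤ M)
    (hcyc : ∀ f : ℕ → Geo X, (∀ i, f i ∈ G) → ∀ n, 0 ≤ chS f n (eval 0 (f 0))) :
    ∃ φ : X → ℝ, Continuous φ ∧ G ⊆ Contact φ (closedBall x0 M) (closedBall x0 M) := by
  rcases G.eq_empty_or_nonempty with rfl | ⟨γ0, hγ0⟩
  · exact ⟨fun _ => 0, continuous_const, empty_subset _⟩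
  let Ix := {f : ℕ → Geo X // ∀ i, f i ∈ G} × ℕ
  have hI : Nonempty Ix := ⟨((⟨fun _ => γ0, fun _ => hγ0⟩ : {f : ℕ → Geo X // ∀ i, f i ∈ G}), 0)⟩
  have hlip : ∀ (p : Ix) (x x' : X), chS p.1.1 p.2 x ≤
      chS p.1.1 p.2 x' + dist x x' * (dist x x0 + dist x' x0 + 2 * M) := by
    intro p x x'
    have := sq_lip (x := x) (x' := x') (hM _ (p.1.2 p.2)).2
    unfold chS
    linarith
  have hbdd : ∀ x, BddBelow (range fun p : Ix => chS p.1.1 p.2 x) := by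
    intro x
    refine ⟨-((M + dist x x0) * (dist x x0 + 3 * M)), ?_⟩
    rintro _ ⟨p, rfl⟩
    have h1 := hcyc p.1.1 p.1.2 p.2
    have h2 := hlip p (eval 0 (p.1.1 0)) x
    have h3 := (hM _ (p.1.2 0)).1
    have h4 := dist_triangle (eval 0 (p.1.1 0)) x0 x
    rw [dist_comm x0 x] at h4
    have h5 : dist (eval 0 (p.1.1 0)) x *
        (dist (eval 0 (p.1.1 0)) x0 + dist x x0 + 2 * M) ≤
        (M + dist x x0) * (dist x x0 + 3 * M) := by
      have : 0 ≤ dist x x0 := dist_nonneg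
      have : 0 ≤ dist (eval 0 (p.1.1 0)) x0 := dist_nonneg
      apply mul_le_mul <;> first | positivity | linarith
    show -_ ≤ chS p.1.1 p.2 x
    linarith
  let φ : X → ℝ := fun x => ⨅ p : Ix, chS p.1.1 p.2 x
  have hφlip : ∀ x x', φ x ≤ φ x' + dist x x' * (dist x x0 + dist x' x0 + 2 * M) := by
    intro x x'
    rw [← sub_le_iff_le_add]
    refine le_ciInf fun p => ?_
    have := ciInf_le (hbdd x) p
    have h2 := hlip p x x'
    show φ x - _ ≤ _
    have h3 : φ x ≤ chS p.1.1 p.2 x := this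
    linarith
  refine ⟨φ, ?_, ?_⟩
  · rw [continuous_iff_continuousAt]
    intro x'
    rw [ContinuousAt, tendsto_iff_dist_tendsto_zero]
    have hlim : Tendsto (fun x => dist x x' * (dist x x0 + dist x' x0 + 2 * M)) (𝓝 x') (𝓝 0) := by
      have : Continuous fun x => dist x x' * (dist x x0 + dist x' x0 + 2 * M) := by fun_prop
      have h := this.tendsto x'
      simpa using h
    refine squeeze_zero (fun _ => dist_nonneg) (fun x => ?_) hlim
    rw [Real.dist_eq, abs_le]
    have h1 := hφlip x x'
    have h2 := hφlip x' x
    rw [dist_comm x' x] at h2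
    constructor <;> linarith
  · intro γ hγ
    refine ⟨mem_closedBall.2 (hM γ hγ).1, mem_closedBall.2 (hM γ hγ).2, fun x _ => ?_⟩
    have : φ x - (dist x (eval 1 γ) ^ 2 - dist (eval 0 γ) (eval 1 γ) ^ 2) ≤ φ (eval 0 γ) := by
      refine le_ciInf fun p => ?_
      obtain ⟨⟨f, hf⟩, n⟩ := p
      let f' : ℕ → Geo X := fun i => if i ≤ n then f i else γ
      have hf' : ∀ i, f' i ∈ G := by
        intro i
        simp only [f']
        split_ifs
        · exact hf i
        · exact hγ
      have h3 : φ x ≤ chS f' (n + 1) x := ciInf_le (hbdd x) (⟨f', hf'⟩, n + 1)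
      have h4 : chS f' (n + 1) x = chS f n (eval 0 γ) +
          (dist x (eval 1 γ) ^ 2 - dist (eval 0 γ) (eval 1 γ) ^ 2) := by
        unfold chS
        rw [Finset.sum_range_succ]
        have a1 : f' n = f n := by simp [f']
        have a2 : f' (n + 1) = γ := by simp [f']
        rw [a1, a2]
        congr 2
        refine Finset.sum_congr rfl fun i hi => ?_
        have hi' := Finset.mem_range.1 hi
        have a3 : f' i = f i := by simp only [f']; rw [if_pos hi'.le]
        have a4 : f' (i + 1) = f (i + 1) := by simp only [f']; rw [if_pos (by omega)]
        rw [a3, a4]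
      show _ ≤ chS f n (eval 0 γ)
      linarith
    linarith

variable [ProperSpace X] [BorelSpace X]
variable {K N : ℝ} {m : Measure X}

lemma cost_fin {μ ν : Measure X} (hμp : IsProbabilityMeasure μ) (hνp : IsProbabilityMeasure ν)
    (hμ2 : HasFiniteSecondMoment μ) (hν2 : HasFiniteSecondMoment ν)
    {π : Measure (Geo X)} (hπ : IsOptGeo μ ν π) : transportCost π ≠ ⊤ := by
  obtain ⟨hp, h0, h1, -⟩ := hπ
  obtain ⟨x, hx⟩ := hμ2
  obtain ⟨y, hy⟩ := hν2
  have m0 := measurable_geval (X := X) 0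
  have m1 := measurable_geval (X := X) 1
  have hb : ∀ γ : Geo X, ENNReal.ofReal (dist (eval 0 γ) (eval 1 γ) ^ 2) ≤
      (3 * ENNReal.ofReal (dist (eval 0 γ) x ^ 2) + 3 * ENNReal.ofReal (dist (eval 1 γ) y ^ 2)) +
        ENNReal.ofReal (3 * dist x y ^ 2) := by
    intro γ
    have e3 : (3 : ℝ≥0∞) = ENNReal.ofReal 3 := by simp
    rw [e3, ← ENNReal.ofReal_mul (by norm_num), ← ENNReal.ofReal_mul (by norm_num),
      ← ENNReal.ofReal_add (by positivity) (by positivity),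
      ← ENNReal.ofReal_add (by positivity) (by positivity)]
    apply ENNReal.ofReal_le_ofReal
    have h := dist_triangle4 (eval 0 γ) x y (eval 1 γ)
    rw [dist_comm y] at h
    have hn : 0 ≤ dist (eval 0 γ) (eval 1 γ) := dist_nonneg
    have hsq := pow_le_pow_left₀ hn h 2
    nlinarith [sq_nonneg (dist (eval 0 γ) x - dist x y), sq_nonneg (dist (eval 0 γ) x - dist (eval 1 γ) y),
      sq_nonneg (dist x y - dist (eval 1 γ) y)]
  refine ne_top_of_le_ne_top ?_ (lintegral_mono hb)
  have g0 : Measurable fun z : X => ENNReal.ofReal (dist z x ^ 2) :=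
    ENNReal.measurable_ofReal.comp (by fun_prop : Continuous fun z : X => dist z x ^ 2).measurable
  have g1 : Measurable fun z : X => ENNReal.ofReal (dist z y ^ 2) :=
    ENNReal.measurable_ofReal.comp (by fun_prop : Continuous fun z : X => dist z y ^ 2).measurable
  have G0 : Measurable fun γ : Geo X => ENNReal.ofReal (dist (eval 0 γ) x ^ 2) := g0.comp m0
  have G1 : Measurable fun γ : Geo X => ENNReal.ofReal (dist (eval 1 γ) y ^ 2) := g1.comp m1
  rw [lintegral_add_right _ measurable_const, lintegral_add_left (G0.const_mul _),
    lintegral_const_mul _ G0, lintegral_const_mul _ G1, lintegral_const, measure_univ, mul_one]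
  rw [← h0, lintegral_map g0 m0] at hx
  rw [← h1, lintegral_map g1 m1] at hy
  exact ENNReal.add_ne_top.2 ⟨ENNReal.add_ne_top.2 ⟨ENNReal.mul_ne_top (by norm_num) hx,
    ENNReal.mul_ne_top (by norm_num) hy⟩, ENNReal.ofReal_ne_top⟩

lemma final_aux [IsFiniteMeasureOnCompacts m] (hc : Ctx K N m)
    {μ ν : Measure X} (hμp : IsProbabilityMeasure μ) (hνp : IsProbabilityMeasure ν)
    (hμ2 : HasFiniteSecondMoment μ) (hν2 : HasFiniteSecondMoment ν)
    {C : ℝ≥0∞} (hC : C ≠ ⊤) (hμC : μ ≤ C • m)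
    {π : Measure (Geo X)} (hπ : IsOptGeo μ ν π) :
    ∃ πs : ℕ → Measure (Geo X), π = Measure.sum πs ∧
      ∀ n : ℕ, ∀ t : unitInterval, (t : ℝ) < 1 →
        ∃ Cn : ℝ≥0∞, Cn ≠ ⊤ ∧ (πs n).map (eval t) ≤ Cn • m := by
  have hfin := cost_fin hμp hνp hμ2 hν2 hπ
  obtain ⟨x0, -⟩ := hμ2
  have hprob := hπ.1
  have m0 := measurable_geval (X := X) 0
  have m1 := measurable_geval (X := X) 1
  let A : ℕ → Set (Geo X) := fun n =>
    eval 0 ⁻¹' closedBall x0 n ∩ eval 1 ⁻¹' closedBall x0 n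
  have hAm : ∀ n, MeasurableSet (A n) := fun n =>
    (m0 measurableSet_closedBall).inter (m1 measurableSet_closedBall)
  have hAu : ⋃ n, A n = univ := by
    refine eq_univ_of_forall fun γ => ?_
    obtain ⟨n, hn⟩ := exists_nat_ge (max (dist (eval 0 γ) x0) (dist (eval 1 γ) x0))
    exact mem_iUnion.2 ⟨n, mem_closedBall.2 ((le_max_left _ _).trans hn),
      mem_closedBall.2 ((le_max_right _ _).trans hn)⟩
  refine ⟨fun n => π.restrict (disjointed A n), ?_, ?_⟩
  · rw [← Measure.restrict_iUnion (disjoint_disjointed A) (fun n => MeasurableSet.disjointed hAm n),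
      iUnion_disjointed, hAu, Measure.restrict_univ]
  · intro n t ht
    obtain ⟨φ, hφ, hsub⟩ := rock (G := π.support ∩ A n) (x0 := x0) (M := n) (Nat.cast_nonneg n)
      (fun γ hγ => ⟨mem_closedBall.1 hγ.2.1, mem_closedBall.1 hγ.2.2⟩)
      (fun f hf k => cyc_chain hc.cd hπ hfin f (fun i => (hf i).1) k)
    refine bdd_bound hc hφ (isCompact_closedBall x0 n) (isCompact_closedBall x0 n) ?_ hC ?_ t ht
    · have h1 : ∀ᵐ γ ∂(π.restrict (disjointed A n)), γ ∈ π.support :=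
        ae_restrict_of_ae Measure.support_mem_ae
      filter_upwards [h1, ae_restrict_mem (MeasurableSet.disjointed hAm n)] with γ h2 h3
      exact hsub ⟨h2, disjointed_subset A n h3⟩
    · refine le_trans (Measure.map_mono Measure.restrict_le_self m0) ?_
      rw [hπ.2.1]
      exact hμC

end Pot

/-- **Corollary 1.6, unbounded supports**: if `μ ≤ C·m` then the unique optimal geodesic plan
`π` can be written as `π = Σₙ πₙ` where each `πₙ` satisfies `(e_t)#πₙ ≤ Cₙ(t)·m` for `t < 1`. -/
theorem interpolant_density_bound_decomposition
    [CompleteSpace X] [TopologicalSpace.SeparableSpace X] [ProperSpace X] [BorelSpace X]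
    (hX : IsGeodesicSpace X) (m : Measure X)
    (hm_bdd : ∀ s : Set X, Bornology.IsBounded s → m s ≠ ⊤)
    (hm_supp : ∀ x : X, ∀ r : ℝ, 0 < r → 0 < m (ball x r))
    (K N : ℝ) (hN : 1 ≤ N) (hCD : IsCDStar K N m) (hGT : GoodTransport m)
    (μ ν : Measure X) (hμp : IsProbabilityMeasure μ) (hνp : IsProbabilityMeasure ν)
    (hμ2 : HasFiniteSecondMoment μ) (hν2 : HasFiniteSecondMoment ν)
    (C : ℝ) (hC : 0 < C) (hμC : μ ≤ ENNReal.ofReal C • m)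
    (π : Measure (Geo X)) (hπ : IsOptGeo μ ν π) :
    ∃ πs : ℕ → Measure (Geo X), π = Measure.sum πs ∧
      ∀ n : ℕ, ∀ t : unitInterval, (t : ℝ) < 1 →
        ∃ Cn : ℝ≥0∞, Cn ≠ ⊤ ∧ (πs n).map (eval t) ≤ Cn • m := by
  have hfc : IsFiniteMeasureOnCompacts m :=
    ⟨fun s hs => lt_top_iff_ne_top.2 (hm_bdd s hs.isBounded)⟩
  exact final_aux (K := K) (N := N) ⟨hN, hm_bdd, hCD, hGT⟩ hμp hνp hμ2 hν2
    ENNReal.ofReal_ne_top hμC hπ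

end
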